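/- arXiv:1909.01644 — 5 statements merged into one kernel-verified Lean document; each statement's English description precedes it below -/
import Mathlib

section
/- Let g : ℝ → ℂ be measurable with compact support and ∫_ℝ |g(t)| (1 + log⁺|g(t)|) dt < ∞. Then for every L > 0, sup_{y > 0} ∫_{−L}^{L} |(𝒞g)(x + iy)| dx < ∞, where 𝒞g is the Cauchy transform of g. -/
open MeasureTheory Set

noncomputable section

/-- The open sector `Δ = {z : |arg z| < π/4}`. -/
def SectorDelta : Set ℂ := {z : ℂ | 0 < z.re ∧ |z.im| < z.re}

/-- The reflected sector `π − Δ`. -/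
def SectorPiDelta : Set ℂ := (fun z => (Real.pi : ℂ) - z) '' SectorDelta

/-- The open square `D = Δ ∩ (π − Δ)` with vertices `0, π/2 − iπ/2, π, π/2 + iπ/2`. -/
def SquareD : Set ℂ := SectorDelta ∩ SectorPiDelta

/-- Membership in the Bergman space `A²(Ω)`. -/
def MemA2 (Ω : Set ℂ) (f : ℂ → ℂ) : Prop :=
  DifferentiableOn ℂ f Ω ∧ ∫⁻ z in Ω, ENNReal.ofReal (‖f z‖ ^ 2) < ⊤

/-- Membership in the weighted Bergman space `A²(Ω, w)`. -/
def MemA2W (Ω : Set ℂ) (w : ℂ → ℝ) (f : ℂ → ℂ) : Prop :=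
  DifferentiableOn ℂ f Ω ∧ ∫⁻ z in Ω, ENNReal.ofReal (‖f z‖ ^ 2 * w z) < ⊤

/-- `log⁺ t = max (log t) 0`. -/
def logPlus (t : ℝ) : ℝ := Real.log (max t 1)

/-- Starting vertices of the four sides of `∂D`, counterclockwise. -/
def sideStart : Fin 4 → ℂ
  | 0 => 0
  | 1 => ((Real.pi / 2 : ℝ) : ℂ) * (1 - Complex.I)
  | 2 => ((Real.pi : ℝ) : ℂ)
  | 3 => ((Real.pi / 2 : ℝ) : ℂ) * (1 + Complex.I)

/-- Direction vectors of the four sides of `∂D`, counterclockwise. -/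
def sideDir : Fin 4 → ℂ
  | 0 => ((Real.pi / 2 : ℝ) : ℂ) * (1 - Complex.I)
  | 1 => ((Real.pi / 2 : ℝ) : ℂ) * (1 + Complex.I)
  | 2 => ((Real.pi / 2 : ℝ) : ℂ) * (Complex.I - 1)
  | 3 => -(((Real.pi / 2 : ℝ) : ℂ) * (1 + Complex.I))

/-- Parametrization of the `k`-th side of `∂D`. -/
def sidePath (k : Fin 4) (t : ℝ) : ℂ := sideStart k + (t : ℂ) * sideDir k

/-- `g` is arclength-integrable on `∂D` (each side has constant speed). -/
def BoundaryIntegrable (g : ℂ → ℂ) : Prop :=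
  ∀ k : Fin 4, IntervalIntegrable (fun t => ‖g (sidePath k t)‖) volume 0 1

/-- `∫_{∂D} |g| log⁺|g| |du| < ∞` (each side has constant speed). -/
def BoundaryLlogL (g : ℂ → ℂ) : Prop :=
  ∀ k : Fin 4, IntervalIntegrable
    (fun t => ‖g (sidePath k t)‖ * logPlus ‖g (sidePath k t)‖) volume 0 1

/-- The Cauchy integral `(1/(2πi)) ∮_{∂D} g(u)/(u − z) du`, `∂D` counterclockwise. -/
def cauchyD (g : ℂ → ℂ) (z : ℂ) : ℂ :=
  (2 * (Real.pi : ℂ) * Complex.I)⁻¹ *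
    ∑ k : Fin 4, ∫ t in (0:ℝ)..1, g (sidePath k t) * sideDir k / (sidePath k t - z)

/-- The Cauchy transform `(𝒞g)(z) = (1/(iπ)) ∫_ℝ g(t)/(t − z) dt` on the upper half-plane. -/
def cauchyTransform (g : ℝ → ℂ) (z : ℂ) : ℂ :=
  (Complex.I * (Real.pi : ℂ))⁻¹ * ∫ t : ℝ, g t / ((t : ℂ) - z)


/-- Dual Cauchy integral of a real function `h` on `[-L, L]`, shifted by height `y`. -/
def dualH (h : ℝ → ℝ) (L y : ℝ) (z : ℂ) : ℂ :=
  ∫ x in (-L)..L, (h x : ℂ) / (z - ((x : ℂ) + (y : ℂ) * Complex.I))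

lemma den_lower (x y : ℝ) (z : ℂ) : y - z.im ≤ ‖z - ((x : ℂ) + (y : ℂ) * Complex.I)‖ := by
  have := Complex.abs_im_le_norm (z - ((x : ℂ) + (y : ℂ) * Complex.I))
  simp at this
  have h2 := neg_abs_le (z.im - y)
  linarith

lemma young_aux (a s : ℝ) (ha : 0 ≤ a) : a * s ≤ a * logPlus a + Real.exp s := by
  have hl : a ≤ Real.exp (logPlus a) := by
    unfold logPlus
    rw [Real.exp_log (by positivity)]
    exact le_max_left _ _
  rcases le_total s (logPlus a) with h | h
  · have := mul_le_mul_of_nonneg_left h ha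
    have := Real.exp_pos s
    linarith
  · have h1 : a * (s - logPlus a) ≤ Real.exp (logPlus a) * (s - logPlus a) :=
      mul_le_mul_of_nonneg_right hl (by linarith)
    have h2 : Real.exp (logPlus a) * (s - logPlus a) ≤
        Real.exp (logPlus a) * Real.exp (s - logPlus a) := by
      apply mul_le_mul_of_nonneg_left _ (Real.exp_pos _).le
      have := Real.add_one_le_exp (s - logPlus a)
      linarith
    rw [← Real.exp_add] at h2
    have h3 : logPlus a + (s - logPlus a) = s := by ring
    rw [h3] at h2
    nlinarith

lemma poisson_le (L y t : ℝ) (hL : 0 < L) (hy : 0 < y) :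
    ∫ x in (-L)..L, y / ((t - x) ^ 2 + y ^ 2) ≤ Real.pi := by
  have hd : ∀ x ∈ uIcc (-L) L, HasDerivAt (fun x => Real.arctan ((x - t) / y))
      (y / ((t - x) ^ 2 + y ^ 2)) x := by
    intro x _
    have h1 : HasDerivAt (fun x : ℝ => (x - t) / y) (1 / y) x :=
      ((hasDerivAt_id x).sub_const t).div_const y
    convert h1.arctan using 1
    have : (t - x) ^ 2 + y ^ 2 ≠ 0 := by positivity
    have h3 : 1 + ((x - t) / y) ^ 2 ≠ 0 := by positivity
    field_simp
    ring
  have hc : Continuous (fun x : ℝ => y / ((t - x) ^ 2 + y ^ 2)) := by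
    apply Continuous.div (by fun_prop) (by fun_prop)
    intro x; positivity
  rw [intervalIntegral.integral_eq_sub_of_hasDerivAt hd (hc.intervalIntegrable _ _)]
  have := Real.arctan_lt_pi_div_two ((L - t) / y)
  have := Real.neg_pi_div_two_lt_arctan ((-L - t) / y)
  linarith

lemma dual_meas (h : ℝ → ℝ) (hm : Measurable h) (y : ℝ) (z : ℂ) :
    Measurable (fun x : ℝ => (h x : ℂ) / (z - ((x : ℂ) + (y : ℂ) * Complex.I))) := by
  fun_prop

lemma dual_integrable (h : ℝ → ℝ) (hm : Measurable h) (hb : ∀ x, |h x| ≤ 1) (L y : ℝ)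
    (z : ℂ) (hz : z.im < y) :
    IntervalIntegrable (fun x : ℝ => (h x : ℂ) / (z - ((x : ℂ) + (y : ℂ) * Complex.I)))
      volume (-L) L := by
  refine (intervalIntegrable_const (c := (1 / (y - z.im)))).mono_fun
    (dual_meas h hm y z).aestronglyMeasurable ?_
  refine Filter.Eventually.of_forall fun x => ?_
  have hpos : 0 < y - z.im := by linarith
  simp only [norm_div, Complex.norm_real, Real.norm_eq_abs, abs_one, abs_of_pos hpos]
  exact div_le_div₀ zero_le_one (hb x) hpos (den_lower x y z)

lemma dual_im (h : ℝ → ℝ) (hm : Measurable h) (hb : ∀ x, |h x| ≤ 1) (L y t : ℝ) (hL : 0 < L)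
    (hy : 0 < y) : |(dualH h L y (t : ℂ)).im| ≤ Real.pi := by
  have hi := dual_integrable h hm hb L y (t : ℂ) (by simpa using hy)
  have e : (dualH h L y (t : ℂ)).im = ∫ x in (-L)..L,
      ((h x : ℂ) / ((t : ℂ) - ((x : ℂ) + (y : ℂ) * Complex.I))).im :=
    (Complex.imCLM.intervalIntegral_comp_comm hi).symm
  rw [e]
  refine le_trans ?_ (poisson_le L y t hL hy)
  have hc : Continuous (fun x : ℝ => y / ((t - x) ^ 2 + y ^ 2)) := by
    apply Continuous.div (by fun_prop) (by fun_prop)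
    intro x; positivity
  rw [← Real.norm_eq_abs]
  refine intervalIntegral.norm_integral_le_of_norm_le (by linarith) ?_ (hc.intervalIntegrable _ _)
  refine Filter.Eventually.of_forall fun x _ => ?_
  have : ((h x : ℂ) / ((t : ℂ) - ((x : ℂ) + (y : ℂ) * Complex.I))).im
      = h x * (y / ((t - x) ^ 2 + y ^ 2)) := by
    rw [Complex.div_im]
    simp [Complex.normSq_apply]
    ring
  rw [this, norm_mul, Real.norm_eq_abs, Real.norm_of_nonneg (by positivity)]
  exact mul_le_of_le_one_left (by positivity) (hb x)

lemma dual_diff (h : ℝ → ℝ) (hm : Measurable h) (hb : ∀ x, |h x| ≤ 1) (L y : ℝ)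
    (hy : 0 < y) (z : ℂ) (hz : z.im ≤ 0) : DifferentiableAt ℂ (dualH h L y) z := by
  have hs : {w : ℂ | w.im < y / 2} ∈ nhds z := by
    apply (isOpen_lt Complex.continuous_im continuous_const).mem_nhds
    show z.im < y / 2
    linarith
  have key := intervalIntegral.hasDerivAt_integral_of_dominated_loc_of_deriv_le (𝕜 := ℂ)
    (μ := volume) (a := -L) (b := L)
    (F := fun z x => (h x : ℂ) / (z - ((x : ℂ) + (y : ℂ) * Complex.I)))
    (F' := fun z x => -(h x : ℂ) / (z - ((x : ℂ) + (y : ℂ) * Complex.I)) ^ 2)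
    (bound := fun _ => 1 / (y / 2) ^ 2) hs
    (Filter.Eventually.of_forall fun w => (dual_meas h hm y w).aestronglyMeasurable)
    (dual_integrable h hm hb L y z (by linarith))
    (by apply Measurable.aestronglyMeasurable; fun_prop)
    (by
      refine Filter.Eventually.of_forall fun x _ w hw => ?_
      have hw' : w.im < y / 2 := hw
      have := den_lower x y w
      simp only [norm_div, norm_neg, Complex.norm_real, Real.norm_eq_abs, norm_pow]
      apply div_le_div₀ zero_le_one (hb x) (by positivity)
      apply pow_le_pow_left₀ (by positivity)
      linarith)
    intervalIntegrable_const
    (by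
      refine Filter.Eventually.of_forall fun x _ w hw => ?_
      have hw' : w.im < y / 2 := hw
      have := den_lower x y w
      have hne : w - ((x : ℂ) + (y : ℂ) * Complex.I) ≠ 0 := by
        rw [← norm_pos_iff]; linarith
      have h1 : HasDerivAt (fun w : ℂ => w - ((x : ℂ) + (y : ℂ) * Complex.I)) 1 w :=
        (hasDerivAt_id w).sub_const _
      refine ((hasDerivAt_const w (h x : ℂ)).div h1 hne).congr_deriv ?_
      ring)
  exact key.2.differentiableAt

lemma dual_bound (h : ℝ → ℝ) (hb : ∀ x, |h x| ≤ 1) (L y : ℝ) (hL : 0 < L) (z : ℂ)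
    (hz : ∀ x ∈ Icc (-L) L, 1 ≤ ‖z - ((x : ℂ) + (y : ℂ) * Complex.I)‖) :
    ‖dualH h L y z‖ ≤ 2 * L := by
  have := intervalIntegral.norm_integral_le_of_norm_le_const (a := -L) (b := L) (C := 1)
    (f := fun x : ℝ => (h x : ℂ) / (z - ((x : ℂ) + (y : ℂ) * Complex.I))) (by
      intro x hx
      rw [uIoc_of_le (by linarith)] at hx
      have h1 := hz x (Ioc_subset_Icc_self hx)
      simp only [norm_div, Complex.norm_real, Real.norm_eq_abs]
      rw [div_le_one (by linarith)]
      exact (hb x).trans h1)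
  refine this.trans ?_
  rw [abs_of_pos (by linarith)]
  linarith

/-- Exponential integrability, one sign. -/
lemma exp_one (h : ℝ → ℝ) (hm : Measurable h) (hb : ∀ x, |h x| ≤ 1) (L y R : ℝ) (hL : 0 < L)
    (hy : 0 < y) (hR : L + 1 ≤ R) :
    ∫ t in (-R)..R, Real.exp ((dualH h L y (t : ℂ)).re / 3) ≤ 8 * R * Real.exp (2 * L / 3) := by
  set G : ℂ → ℂ := fun z => Complex.exp (dualH h L y z / 3) with hG
  have hGd : ∀ z : ℂ, z.im ≤ 0 → DifferentiableAt ℂ G z := fun z hz =>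
    ((dual_diff h hm hb L y hy z hz).div_const 3).cexp
  have hGb : ∀ z : ℂ, (∀ x ∈ Icc (-L) L, 1 ≤ ‖z - ((x : ℂ) + (y : ℂ) * Complex.I)‖) →
      ‖G z‖ ≤ Real.exp (2 * L / 3) := by
    intro z hz
    have h1 := dual_bound h hb L y hL z hz
    simp only [hG, Complex.norm_exp]
    apply Real.exp_le_exp.mpr
    have h2 : (dualH h L y z / 3).re ≤ ‖dualH h L y z / 3‖ := Complex.re_le_norm _
    rw [norm_div] at h2
    norm_num at h2 ⊢
    linarith
  have rect := Complex.integral_boundary_rect_eq_zero_of_differentiableOn G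
    (⟨-R, -R⟩ : ℂ) (⟨R, 0⟩ : ℂ) (by
      intro z hz
      apply (hGd z _).differentiableWithinAt
      have := hz.2
      simp only [mem_preimage] at this
      rw [uIcc_of_le (by linarith)] at this
      exact this.2)
  simp only [Complex.ofReal_zero, zero_mul, add_zero] at rect
  have b1 : ‖∫ x : ℝ in (-R)..R, G (x + ((-R : ℝ) : ℂ) * Complex.I)‖
      ≤ Real.exp (2 * L / 3) * |R - -R| := by
    apply intervalIntegral.norm_integral_le_of_norm_le_const
    intro x _
    apply hGb
    intro u _
    have h1 := den_lower u y (x + ((-R : ℝ) : ℂ) * Complex.I)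
    have h2 : (x + ((-R : ℝ) : ℂ) * Complex.I).im = -R := by simp
    rw [h2] at h1
    linarith
  have b2 : ‖∫ s : ℝ in (-R)..0, G (((R : ℝ) : ℂ) + s * Complex.I)‖
      ≤ Real.exp (2 * L / 3) * |0 - -R| := by
    apply intervalIntegral.norm_integral_le_of_norm_le_const
    intro x _
    apply hGb
    intro u hu
    have := Complex.abs_re_le_norm (((R : ℝ) : ℂ) + x * Complex.I - ((u : ℂ) + (y : ℂ) * Complex.I))
    simp at this
    have h3 := le_abs_self (R - u)
    linarith [hu.2]
  have b3 : ‖∫ s : ℝ in (-R)..0, G (((-R : ℝ) : ℂ) + s * Complex.I)‖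
      ≤ Real.exp (2 * L / 3) * |0 - -R| := by
    apply intervalIntegral.norm_integral_le_of_norm_le_const
    intro x _
    apply hGb
    intro u hu
    have := Complex.abs_re_le_norm
      (((-R : ℝ) : ℂ) + x * Complex.I - ((u : ℂ) + (y : ℂ) * Complex.I))
    simp at this
    have h3 := neg_abs_le (-R - u)
    push_cast
    linarith [hu.1]
  rw [abs_of_pos (by linarith)] at b1 b2 b3
  have hcont : Continuous (fun t : ℝ => G (t : ℂ)) := by
    rw [continuous_iff_continuousAt]
    intro t
    exact ContinuousAt.comp (f := fun t : ℝ => (t : ℂ)) (hGd t (by simp)).continuousAt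
      Complex.continuous_ofReal.continuousAt
  have hnorm : ‖∫ t : ℝ in (-R)..R, G (t : ℂ)‖ ≤ 4 * R * Real.exp (2 * L / 3) := by
    have e : (∫ t : ℝ in (-R)..R, G (t : ℂ)) =
        (∫ x : ℝ in (-R)..R, G (x + ((-R : ℝ) : ℂ) * Complex.I)) +
        Complex.I • (∫ s : ℝ in (-R)..0, G (((R : ℝ) : ℂ) + s * Complex.I)) -
        Complex.I • (∫ s : ℝ in (-R)..0, G (((-R : ℝ) : ℂ) + s * Complex.I)) := by
      linear_combination -rect
    rw [e]
    refine (norm_sub_le _ _).trans ?_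
    refine (add_le_add_left (norm_add_le _ _) _).trans ?_
    rw [norm_smul, norm_smul, Complex.norm_I, one_mul, one_mul]
    linarith
  have hre : (∫ t : ℝ in (-R)..R, (G (t : ℂ)).re) ≤ 4 * R * Real.exp (2 * L / 3) := by
    have e : (∫ t : ℝ in (-R)..R, (G (t : ℂ)).re) = (∫ t : ℝ in (-R)..R, G (t : ℂ)).re :=
      Complex.reCLM.intervalIntegral_comp_comm (hcont.intervalIntegrable _ _)
    rw [e]
    exact (Complex.re_le_norm _).trans hnorm
  have hpt : ∀ t : ℝ, Real.exp ((dualH h L y (t : ℂ)).re / 3) ≤ 2 * (G (t : ℂ)).re := by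
    intro t
    have him := dual_im h hm hb L y t hL hy
    have h1 : (G (t : ℂ)).re = Real.exp ((dualH h L y (t : ℂ)).re / 3) *
        Real.cos ((dualH h L y (t : ℂ)).im / 3) := by
      simp only [hG, Complex.exp_re]
      norm_num
    have h2 : 1 / 2 ≤ Real.cos ((dualH h L y (t : ℂ)).im / 3) := by
      rw [← Real.cos_pi_div_three, ← Real.cos_abs ((dualH h L y (t : ℂ)).im / 3)]
      apply Real.cos_le_cos_of_nonneg_of_le_pi (abs_nonneg _)
      · linarith [Real.pi_pos]
      · rw [abs_div]; norm_num; linarith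
    rw [h1]
    nlinarith [Real.exp_pos ((dualH h L y (t : ℂ)).re / 3)]
  have hexp : (fun t : ℝ => Real.exp ((dualH h L y (t : ℂ)).re / 3)) =
      fun t : ℝ => ‖G (t : ℂ)‖ := by
    funext t
    simp only [hG, Complex.norm_exp]
    norm_num
  calc _ ≤ ∫ t in (-R)..R, 2 * (G (t : ℂ)).re := by
        apply intervalIntegral.integral_mono_on (by linarith)
        · rw [hexp]; exact hcont.norm.intervalIntegrable _ _
        · exact ((Complex.continuous_re.comp hcont).const_mul 2).intervalIntegrable _ _
        · intro t _; exact hpt t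
    _ = 2 * ∫ t in (-R)..R, (G (t : ℂ)).re := intervalIntegral.integral_const_mul _ _
    _ ≤ _ := by linarith

lemma dual_neg (h : ℝ → ℝ) (L y : ℝ) (z : ℂ) :
    dualH (fun x => - h x) L y z = - dualH h L y z := by
  unfold dualH
  rw [← intervalIntegral.integral_neg]
  congr 1
  funext x
  push_cast
  ring

lemma dual_cont (h : ℝ → ℝ) (hm : Measurable h) (hb : ∀ x, |h x| ≤ 1) (L y : ℝ)
    (hy : 0 < y) : Continuous (fun t : ℝ => dualH h L y (t : ℂ)) := by
  rw [continuous_iff_continuousAt]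
  intro t
  exact ContinuousAt.comp (f := fun t : ℝ => (t : ℂ))
    (dual_diff h hm hb L y hy t (by simp)).continuousAt
    Complex.continuous_ofReal.continuousAt

lemma exp_two (h : ℝ → ℝ) (hm : Measurable h) (hb : ∀ x, |h x| ≤ 1) (L y R : ℝ) (hL : 0 < L)
    (hy : 0 < y) (hR : L + 1 ≤ R) :
    ∫ t in (-R)..R, Real.exp (|(dualH h L y (t : ℂ)).re| / 3)
      ≤ 16 * R * Real.exp (2 * L / 3) := by
  have h1 := exp_one h hm hb L y R hL hy hR
  have h2 := exp_one (fun x => - h x) hm.neg (by simpa using hb) L y R hL hy hR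
  simp only [dual_neg, Complex.neg_re] at h2
  have hc := Complex.continuous_re.comp (dual_cont h hm hb L y hy)
  have c1 : Continuous fun t : ℝ => Real.exp ((dualH h L y (t : ℂ)).re / 3) :=
    Real.continuous_exp.comp (hc.div_const 3)
  have c2 : Continuous fun t : ℝ => Real.exp (-(dualH h L y (t : ℂ)).re / 3) :=
    Real.continuous_exp.comp (hc.neg.div_const 3)
  have c3 : Continuous fun t : ℝ => Real.exp (|(dualH h L y (t : ℂ)).re| / 3) :=
    Real.continuous_exp.comp (hc.abs.div_const 3)
  calc _ ≤ ∫ t in (-R)..R, (Real.exp ((dualH h L y (t : ℂ)).re / 3) +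
          Real.exp (-(dualH h L y (t : ℂ)).re / 3)) := by
        apply intervalIntegral.integral_mono_on (by linarith) (c3.intervalIntegrable _ _)
          ((c1.add c2).intervalIntegrable _ _)
        intro t _
        have p1 := Real.exp_pos ((dualH h L y (t : ℂ)).re / 3)
        have p2 := Real.exp_pos (-(dualH h L y (t : ℂ)).re / 3)
        show _ ≤ Real.exp ((dualH h L y (t : ℂ)).re / 3) +
          Real.exp (-(dualH h L y (t : ℂ)).re / 3)
        rcases abs_choice (dualH h L y (t : ℂ)).re with e | e <;> rw [e] <;> linarith
    _ = _ := intervalIntegral.integral_add (c1.intervalIntegrable _ _) (c2.intervalIntegrable _ _)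
    _ ≤ _ := by linarith

lemma logPlus_nonneg (t : ℝ) : 0 ≤ logPlus t := Real.log_nonneg (le_max_right _ _)

lemma pair_bound (g : ℝ → ℂ) (hi : Integrable fun t => ‖g t‖)
    (hi2 : Integrable fun t => ‖g t‖ * logPlus ‖g t‖) (R : ℝ)
    (hsupp : ∀ t, t ∉ Ioc (-R) R → g t = 0)
    (h : ℝ → ℝ) (hm : Measurable h) (hb : ∀ x, |h x| ≤ 1) (L y : ℝ) (hL : 0 < L)
    (hy : 0 < y) (hR : L + 1 ≤ R) :
    ‖∫ t, g t * dualH h L y (t : ℂ)‖ ≤ Real.pi * (∫ t, ‖g t‖) + 3 * (∫ t, ‖g t‖ * logPlus ‖g t‖)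
      + 3 * (16 * R * Real.exp (2 * L / 3)) := by
  have hc := Complex.continuous_re.comp (dual_cont h hm hb L y hy)
  have c3 : Continuous fun t : ℝ => Real.exp (|(dualH h L y (t : ℂ)).re| / 3) :=
    Real.continuous_exp.comp (hc.abs.div_const 3)
  have i3 : Integrable ((Ioc (-R) R).indicator
      fun t : ℝ => Real.exp (|(dualH h L y (t : ℂ)).re| / 3)) :=
    (integrable_indicator_iff measurableSet_Ioc).2 (c3.integrableOn_Ioc)
  have hE := exp_two h hm hb L y R hL hy hR
  rw [intervalIntegral.integral_of_le (by linarith), ← integral_indicator measurableSet_Ioc] at hE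
  have key : ‖∫ t, g t * dualH h L y (t : ℂ)‖ ≤ ∫ t, ((Real.pi * ‖g t‖ +
      3 * (‖g t‖ * logPlus ‖g t‖)) + 3 * ((Ioc (-R) R).indicator
      (fun t : ℝ => Real.exp (|(dualH h L y (t : ℂ)).re| / 3)) t)) := by
    apply norm_integral_le_of_norm_le
    · exact ((hi.const_mul _).add (hi2.const_mul _)).add (i3.const_mul _)
    · refine Filter.Eventually.of_forall fun t => ?_
      by_cases ht : t ∈ Ioc (-R) R
      · rw [indicator_of_mem ht, norm_mul]
        have h1 := Complex.norm_le_abs_re_add_abs_im (dualH h L y (t : ℂ))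
        have h2 := dual_im h hm hb L y t hL hy
        have h3 := young_aux ‖g t‖ (|(dualH h L y (t : ℂ)).re| / 3) (norm_nonneg _)
        have h4 := mul_le_mul_of_nonneg_left (h1.trans (add_le_add_right h2 _)) (norm_nonneg (g t))
        linarith
      · rw [indicator_of_notMem ht, hsupp t ht]
        simp
  have i12 : Integrable fun t => Real.pi * ‖g t‖ + 3 * (‖g t‖ * logPlus ‖g t‖) :=
    (hi.const_mul _).add (hi2.const_mul _)
  rw [integral_add i12 (i3.const_mul _),
    integral_add (hi.const_mul _) (hi2.const_mul _), integral_const_mul, integral_const_mul,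
    integral_const_mul] at key
  linarith

lemma kernel_integrable (g : ℝ → ℂ) (hg : Measurable g) (hi : Integrable fun t => ‖g t‖)
    (h : ℝ → ℝ) (hm : Measurable h) (hb : ∀ x, |h x| ≤ 1) (L y : ℝ) (hy : 0 < y) :
    Integrable (Function.uncurry fun x t : ℝ => (h x : ℂ) *
      (g t / ((t : ℂ) - ((x : ℂ) + (y : ℂ) * Complex.I))))
      ((volume.restrict (uIoc (-L) L)).prod volume) := by
  haveI : IsFiniteMeasure (volume.restrict (uIoc (-L) L)) := by
    unfold uIoc
    infer_instance
  have h1 : Integrable (fun p : ℝ × ℝ => (1 / y) * ‖g p.2‖)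
      ((volume.restrict (uIoc (-L) L)).prod volume) :=
    (integrable_const (1 / y)).mul_prod hi
  refine h1.mono' ?_ ?_
  · apply Measurable.aestronglyMeasurable
    unfold Function.uncurry
    fun_prop
  · refine Filter.Eventually.of_forall fun p => ?_
    have := den_lower p.1 y (p.2 : ℂ)
    simp only [Complex.ofReal_im, sub_zero] at this
    simp only [Function.uncurry, norm_mul, norm_div, Complex.norm_real, Real.norm_eq_abs]
    calc _ ≤ 1 * (‖g p.2‖ / y) := by
          gcongr
          exact hb _
      _ = _ := by ring

lemma pair_swap (g : ℝ → ℂ) (hg : Measurable g) (hi : Integrable fun t => ‖g t‖)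
    (h : ℝ → ℝ) (hm : Measurable h) (hb : ∀ x, |h x| ≤ 1) (L y : ℝ) (hy : 0 < y) :
    (∫ x in (-L)..L, (h x : ℂ) * ∫ t, g t / ((t : ℂ) - ((x : ℂ) + (y : ℂ) * Complex.I))) =
      ∫ t, g t * dualH h L y (t : ℂ) := by
  have := intervalIntegral_integral_swap (kernel_integrable g hg hi h hm hb L y hy)
  simp only [integral_const_mul] at this
  rw [this]
  congr 1
  funext t
  unfold dualH
  rw [← intervalIntegral.integral_const_mul]
  congr 1
  funext x
  ring

/-- For a compactly supported `g` with `∫ |g|(1 + log⁺|g|) < ∞`, the Cauchy transform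
has uniformly bounded `L¹` means on horizontal segments `[−L, L] + iy`, `y > 0`. -/
theorem cauchyTransform_uniform_L1_bound
    (g : ℝ → ℂ) (hmeas : Measurable g) (hsupp : HasCompactSupport g)
    (hLlogL : ∫⁻ t : ℝ, ENNReal.ofReal (‖g t‖ * (1 + logPlus ‖g t‖)) < ⊤)
    (L : ℝ) (hL : 0 < L) :
    ∃ M : ℝ, ∀ y : ℝ, 0 < y →
      (∫ x in (-L)..L, ‖cauchyTransform g ((x : ℂ) + (y : ℂ) * Complex.I)‖) ≤ M := by
  have hlm : Measurable logPlus := by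
    unfold logPlus
    exact Real.measurable_log.comp (measurable_id.max measurable_const)
  have hI : Integrable fun t => ‖g t‖ * (1 + logPlus ‖g t‖) := by
    refine ⟨(by fun_prop : Measurable _).aestronglyMeasurable, ?_⟩
    rw [hasFiniteIntegral_iff_ofReal (Filter.Eventually.of_forall fun t =>
      mul_nonneg (norm_nonneg _) (by have := logPlus_nonneg ‖g t‖; linarith))]
    exact hLlogL
  have hi : Integrable fun t => ‖g t‖ := by
    refine hI.mono' hmeas.norm.aestronglyMeasurable (Filter.Eventually.of_forall fun t => ?_)
    have := mul_nonneg (norm_nonneg (g t)) (logPlus_nonneg ‖g t‖)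
    rw [norm_norm]
    linarith
  have hi2 : Integrable fun t => ‖g t‖ * logPlus ‖g t‖ := by
    refine hI.mono' (by fun_prop : Measurable _).aestronglyMeasurable
      (Filter.Eventually.of_forall fun t => ?_)
    have h0 := mul_nonneg (norm_nonneg (g t)) (logPlus_nonneg ‖g t‖)
    rw [Real.norm_of_nonneg h0]
    linarith [norm_nonneg (g t)]
  obtain ⟨A, hA⟩ := hsupp.isCompact.isBounded.subset_closedBall (0 : ℝ)
  set R := max (A + 1) (L + 1) with hRdef
  have hR : L + 1 ≤ R := le_max_right _ _
  have hz : ∀ t, t ∉ Ioc (-R) R → g t = 0 := by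
    intro t ht
    by_contra hne
    apply ht
    have h1 := hA (subset_tsupport g hne)
    rw [Metric.mem_closedBall, Real.dist_eq, sub_zero, abs_le] at h1
    have : A + 1 ≤ R := le_max_left _ _
    constructor <;> linarith
  set B := Real.pi * (∫ t, ‖g t‖) + 3 * (∫ t, ‖g t‖ * logPlus ‖g t‖)
      + 3 * (16 * R * Real.exp (2 * L / 3)) with hB
  refine ⟨Real.pi⁻¹ * (B + B), fun y hy => ?_⟩
  set F : ℝ → ℂ := fun x => ∫ t, g t / ((t : ℂ) - ((x : ℂ) + (y : ℂ) * Complex.I)) with hF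
  have hFm : Measurable F := by
    apply StronglyMeasurable.measurable
    apply StronglyMeasurable.integral_prod_right
    apply Measurable.stronglyMeasurable
    unfold Function.uncurry
    fun_prop
  have hFi : IntervalIntegrable F volume (-L) L := by
    have := (kernel_integrable g hmeas hi (fun _ => 1) measurable_const (by simp) L y
      hy).integral_prod_left
    rw [intervalIntegrable_iff]
    simpa [Function.uncurry, IntegrableOn, hF] using this
  have hbd : ∀ φ : ℝ → ℝ, Measurable φ → ∃ h : ℝ → ℝ, Measurable h ∧ (∀ x, |h x| ≤ 1) ∧
      ∀ x, h x * φ x = |φ x| := by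
    intro φ hφ
    refine ⟨fun x => if 0 ≤ φ x then 1 else -1,
      Measurable.ite (measurableSet_le measurable_const hφ) measurable_const measurable_const,
      fun x => ?_, fun x => ?_⟩
    · dsimp only
      split_ifs <;> simp
    · dsimp only
      split_ifs with hx
      · rw [abs_of_nonneg hx, one_mul]
      · rw [abs_of_neg (not_le.1 hx)]; ring
  have hmulI : ∀ h : ℝ → ℝ, Measurable h → (∀ x, |h x| ≤ 1) →
      IntervalIntegrable (fun x => (h x : ℂ) * F x) volume (-L) L := by
    intro h hm hb
    refine hFi.mono_fun (by fun_prop : Measurable _).aestronglyMeasurable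
      (Filter.Eventually.of_forall fun x => ?_)
    simp only [norm_mul, Complex.norm_real, Real.norm_eq_abs]
    exact mul_le_of_le_one_left (norm_nonneg _) (hb x)
  have hreB : ∫ x in (-L)..L, |(F x).re| ≤ B := by
    obtain ⟨h, hm, hb, hh⟩ := hbd (fun x => (F x).re) (Complex.measurable_re.comp hFm)
    have hp := pair_bound g hi hi2 R hz h hm hb L y hL hy hR
    rw [← pair_swap g hmeas hi h hm hb L y hy] at hp
    refine le_trans ?_ ((Complex.re_le_norm _).trans hp)
    have e := Complex.reCLM.intervalIntegral_comp_comm (hmulI h hm hb)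
    refine le_of_eq (Eq.trans ?_ e)
    congr 1
    funext x
    rw [← hh x]
    simp
  have himB : ∫ x in (-L)..L, |(F x).im| ≤ B := by
    obtain ⟨h, hm, hb, hh⟩ := hbd (fun x => (F x).im) (Complex.measurable_im.comp hFm)
    have hp := pair_bound g hi hi2 R hz h hm hb L y hL hy hR
    rw [← pair_swap g hmeas hi h hm hb L y hy] at hp
    refine le_trans ?_ (((le_abs_self _).trans (Complex.abs_im_le_norm _)).trans hp)
    have e := Complex.imCLM.intervalIntegral_comp_comm (hmulI h hm hb)
    refine le_of_eq (Eq.trans ?_ e)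
    congr 1
    funext x
    rw [← hh x]
    simp
  have hreI : IntervalIntegrable (fun x => |(F x).re|) volume (-L) L := by
    refine hFi.norm.mono_fun (by fun_prop : Measurable _).aestronglyMeasurable
      (Filter.Eventually.of_forall fun x => ?_)
    simpa using Complex.abs_re_le_norm (F x)
  have himI : IntervalIntegrable (fun x => |(F x).im|) volume (-L) L := by
    refine hFi.norm.mono_fun (by fun_prop : Measurable _).aestronglyMeasurable
      (Filter.Eventually.of_forall fun x => ?_)
    simpa using Complex.abs_im_le_norm (F x)
  have hnF : ∫ x in (-L)..L, ‖F x‖ ≤ B + B := by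
    refine le_trans ?_ (add_le_add hreB himB)
    rw [← intervalIntegral.integral_add hreI himI]
    exact intervalIntegral.integral_mono_on (by linarith) hFi.norm (hreI.add himI)
      fun x _ => Complex.norm_le_abs_re_add_abs_im (F x)
  have e : ∀ x : ℝ, ‖cauchyTransform g ((x : ℂ) + (y : ℂ) * Complex.I)‖ =
      Real.pi⁻¹ * ‖F x‖ := by
    intro x
    unfold cauchyTransform
    rw [norm_mul, norm_inv, norm_mul, Complex.norm_I, one_mul, Complex.norm_real,
      Real.norm_of_nonneg Real.pi_pos.le]
  simp only [e]
  rw [intervalIntegral.integral_const_mul]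
  exact mul_le_mul_of_nonneg_left hnF (inv_nonneg.2 Real.pi_pos.le)

end
end

section
/- Let g : ℝ → ℂ be measurable with ∫_ℝ |g(t)| (1 + log⁺|g(t)|) dt < ∞, let L > 0 with supp g ⊂ (−L/2, L/2), and let Ω_L = {x + iy : −L < x < L, 0 < y < 2L} be the open square in the upper half-plane one side of which is the segment [−L, L] of ℝ. For 0 < ε < L/2 let Q_ε be the boundary of the square {x + iy : −L + ε < x < L − ε, ε < y < 2L − ε} contained in Ω_L. Then sup_{0 < ε < L/2} ∮_{Q_ε} |(𝒞g)(z)| |dz| < ∞; in particular 𝒞g belongs to the Smirnov class E¹(Ω_L). -/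
open MeasureTheory Set

noncomputable section

/-- The open square `Ω_L = (−L, L) × (0, 2L)` in the upper half-plane. -/
def SquareOmega (L : ℝ) : Set ℂ :=
  {z : ℂ | -L < z.re ∧ z.re < L ∧ 0 < z.im ∧ z.im < 2 * L}

/-- The arclength integral of `|𝒞g|` over the boundary `Q_ε` of the square
`(−L+ε, L−ε) × (ε, 2L−ε)`. -/
def contourInt (g : ℝ → ℂ) (L ε : ℝ) : ℝ :=
  (∫ x in (-L + ε)..(L - ε), ‖cauchyTransform g ((x : ℂ) + (ε : ℂ) * Complex.I)‖) +
  (∫ x in (-L + ε)..(L - ε), ‖cauchyTransform g ((x : ℂ) + ((2 * L - ε : ℝ) : ℂ) * Complex.I)‖) +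
  (∫ y in ε..(2 * L - ε), ‖cauchyTransform g (((L - ε : ℝ) : ℂ) + (y : ℂ) * Complex.I)‖) +
  (∫ y in ε..(2 * L - ε), ‖cauchyTransform g (((-L + ε : ℝ) : ℂ) + (y : ℂ) * Complex.I)‖)


/-! ### Auxiliary lemmas -/

/-- The key pointwise inequality. -/
lemma aux_pointwise (w : ℂ) (hw : 0 < w.re) :
    ‖w‖ ≤ 4 * w.re + 4 * (w.re * Real.log w.re - (w * Complex.log w).re) := by
  have hw0 : w ≠ 0 := by rintro rfl; simp at hw
  have hr : 0 < ‖w‖ := norm_pos_iff.2 hw0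
  have hc := Complex.norm_mul_cos_arg w
  have hs := Complex.norm_mul_sin_arg w
  have harg : |w.arg| < Real.pi / 2 := Complex.abs_arg_lt_pi_div_two_iff.2 (Or.inl hw)
  have hre : (w * Complex.log w).re = w.re * Real.log ‖w‖ - w.im * w.arg := by
    simp [Complex.mul_re, Complex.log_re, Complex.log_im]
  rw [hre]
  set r := ‖w‖
  set θ := w.arg
  set c := Real.cos θ with hcdef
  have hcpos : 0 < c := by
    by_contra h
    push Not at h
    nlinarith
  have hc1 : c ≤ 1 := Real.cos_le_one θ
  have hlog : Real.log w.re = Real.log r + Real.log c := by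
    rw [← hc, Real.log_mul hr.ne' hcpos.ne']
  have hts : 1 - c ^ 2 ≤ θ * Real.sin θ := by
    have h1 : θ * Real.sin θ = |θ| * Real.sin |θ| := by
      rcases abs_cases θ with ⟨h, _⟩ | ⟨h, _⟩ <;> rw [h]
      simp
    have h2 : Real.sin |θ| ≤ |θ| := Real.sin_le (abs_nonneg θ)
    have h3 : 0 ≤ Real.sin |θ| :=
      Real.sin_nonneg_of_nonneg_of_le_pi (abs_nonneg θ) (by linarith [Real.pi_pos])
    have h4 := Real.sin_sq_add_cos_sq |θ|
    rw [Real.cos_abs] at h4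
    rw [h1]
    nlinarith
  have hexp : w.re * Real.log w.re - (w.re * Real.log r - w.im * θ)
      = r * (c * Real.log c + θ * Real.sin θ) := by
    rw [hlog, ← hs, ← hc]; ring
  rw [hexp, ← hc]
  have key : 1 ≤ 4 * c + 4 * (c * Real.log c + θ * Real.sin θ) := by
    by_cases h : c ≤ 1 / 2
    · have h2 : 1 - (2 * c)⁻¹ ≤ Real.log (2 * c) := Real.one_sub_inv_le_log_of_pos (by positivity)
      rw [Real.log_mul two_ne_zero hcpos.ne'] at h2
      have h3 : c * (1 - (2 * c)⁻¹) ≤ c * (Real.log 2 + Real.log c) :=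
        mul_le_mul_of_nonneg_left h2 hcpos.le
      have h4 : c * (1 - (2 * c)⁻¹) = c - 1 / 2 := by field_simp
      have h5 : Real.log 2 < 1 := by linarith [Real.log_two_lt_d9]
      nlinarith
    · have h2 : 1 - c⁻¹ ≤ Real.log c := Real.one_sub_inv_le_log_of_pos hcpos
      have h3 : c * (1 - c⁻¹) ≤ c * Real.log c := mul_le_mul_of_nonneg_left h2 hcpos.le
      have h4 : c * (1 - c⁻¹) = c - 1 := by field_simp
      nlinarith
  nlinarith

lemma aux_measurable_kernel (z : ℂ) : Measurable (fun t : ℝ => (t : ℂ) - z) := by fun_prop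

lemma aux_integrand_integrable {g : ℝ → ℂ} (hg : Integrable g) {z : ℂ} (hz : 0 < z.im) :
    Integrable (fun t : ℝ => g t / ((t : ℂ) - z)) := by
  have hb : ∀ t : ℝ, ‖((t : ℂ) - z)⁻¹‖ ≤ z.im⁻¹ := by
    intro t
    rw [norm_inv]
    apply inv_anti₀ hz
    have := Complex.abs_im_le_norm ((t : ℂ) - z)
    simpa [abs_of_pos hz] using this
  simp_rw [div_eq_mul_inv]
  exact hg.mul_bdd (aux_measurable_kernel z).inv.aestronglyMeasurable
    (Filter.Eventually.of_forall hb)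

lemma aux_differentiable {g : ℝ → ℂ} (hg : Integrable g) {z : ℂ} (hz : 0 < z.im) :
    DifferentiableAt ℂ (cauchyTransform g) z := by
  unfold cauchyTransform
  apply DifferentiableAt.const_mul
  have hs : {w : ℂ | z.im / 2 < w.im} ∈ nhds z :=
    (isOpen_lt continuous_const Complex.continuous_im).mem_nhds (by simp; linarith)
  have key : ∀ w : ℂ, z.im / 2 < w.im → ∀ t : ℝ, z.im / 2 ≤ ‖(t : ℂ) - w‖ := by
    intro w hw t
    have := Complex.abs_im_le_norm ((t : ℂ) - w)
    simp only [Complex.sub_im, Complex.ofReal_im, zero_sub, abs_neg] at this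
    linarith [le_abs_self w.im]
  have := hasDerivAt_integral_of_dominated_loc_of_deriv_le (μ := volume)
    (F := fun (w : ℂ) (t : ℝ) => g t / ((t : ℂ) - w))
    (F' := fun (w : ℂ) (t : ℝ) => g t * (((t : ℂ) - w) ^ 2)⁻¹)
    (bound := fun t => ‖g t‖ * ((z.im / 2) ^ 2)⁻¹) (x₀ := z) hs ?_
    (aux_integrand_integrable hg hz) ?_ ?_ (hg.norm.mul_const _) ?_
  · exact this.2.differentiableAt
  · refine Filter.Eventually.of_forall fun w => ?_
    simp_rw [div_eq_mul_inv]
    exact hg.aestronglyMeasurable.mul (aux_measurable_kernel w).inv.aestronglyMeasurable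
  · exact hg.aestronglyMeasurable.mul
      ((aux_measurable_kernel z).pow_const 2).inv.aestronglyMeasurable
  · refine Filter.Eventually.of_forall fun t w hw => ?_
    rw [norm_mul, norm_inv, norm_pow]
    have := key w hw t
    gcongr
  · refine Filter.Eventually.of_forall fun t w hw => ?_
    have h1 : (t : ℂ) - w ≠ 0 := by
      rw [← norm_pos_iff]
      linarith [key w hw t]
    have h2 : HasDerivAt (fun w : ℂ => (t : ℂ) - w) (-1) w := by
      simpa using (hasDerivAt_id w).const_sub (t : ℂ)
    have h3 := (h2.inv h1).const_mul (g t)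
    convert! h3 using 1
    field_simp

lemma aux_bound {g : ℝ → ℂ} (hg : Integrable g) {z : ℂ} {d : ℝ} (hd : 0 < d)
    (h : ∀ t ∈ Function.support g, d ≤ ‖(t : ℂ) - z‖) :
    ‖cauchyTransform g z‖ ≤ d⁻¹ * ∫ t, ‖g t‖ := by
  unfold cauchyTransform
  rw [norm_mul]
  have h1 : ‖(Complex.I * (Real.pi : ℂ))⁻¹‖ ≤ 1 := by
    rw [norm_inv, norm_mul, Complex.norm_I, one_mul, Complex.norm_real, Real.norm_eq_abs,
      abs_of_pos Real.pi_pos]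
    exact inv_le_one_of_one_le₀ (by linarith [Real.pi_gt_three])
  have h2 : ‖∫ t : ℝ, g t / ((t : ℂ) - z)‖ ≤ ∫ t : ℝ, d⁻¹ * ‖g t‖ := by
    apply norm_integral_le_of_norm_le (hg.norm.const_mul _)
    refine Filter.Eventually.of_forall fun t => ?_
    by_cases ht : g t = 0
    · simp [ht]
    · rw [norm_div, div_eq_inv_mul]
      have := h t ht
      gcongr
  rw [integral_const_mul] at h2
  calc _ ≤ 1 * ‖∫ t : ℝ, g t / ((t : ℂ) - z)‖ := by gcongr
    _ ≤ _ := by rw [one_mul]; exact h2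

/-- Poisson kernel of the upper half-plane. -/
def poisK (y s : ℝ) : ℝ := Real.pi⁻¹ * y * (s ^ 2 + y ^ 2)⁻¹

lemma poisK_nonneg {y : ℝ} (hy : 0 < y) (s : ℝ) : 0 ≤ poisK y s := by
  unfold poisK
  have := Real.pi_pos
  positivity

lemma poisK_integral {y : ℝ} (hy : 0 < y) : ∫ s, poisK y s = 1 := by
  have := ProbabilityTheory.integral_cauchyPDFReal_eq_one 0 (γ := ⟨y, hy.le⟩)
    (by intro h; exact hy.ne' (congrArg NNReal.toReal h))
  simp only [ProbabilityTheory.cauchyPDFReal, sub_zero] at this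
  exact this

lemma poisK_integrable {y : ℝ} (hy : 0 < y) : Integrable (poisK y) := by
  by_contra h
  have := poisK_integral hy
  rw [integral_undef h] at this
  simp at this

lemma poisK_continuous {y : ℝ} (hy : 0 < y) : Continuous (poisK y) := by
  unfold poisK
  refine continuous_const.mul (Continuous.inv₀ (by fun_prop) fun s => ?_)
  positivity

lemma poisK_le {y : ℝ} (hy : 0 < y) (s : ℝ) : poisK y s ≤ Real.pi⁻¹ * y * (y ^ 2)⁻¹ := by
  unfold poisK
  have := Real.pi_pos
  gcongr
  nlinarith [sq_nonneg s]

lemma poisK_mul_integrable {y : ℝ} (hy : 0 < y) {f : ℝ → ℝ} (hf : Integrable f) (x : ℝ) :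
    Integrable (fun t => f t * poisK y (x - t)) := by
  refine hf.mul_bdd (c := Real.pi⁻¹ * y * (y ^ 2)⁻¹) ?_ (Filter.Eventually.of_forall fun t => ?_)
  · exact ((poisK_continuous hy).comp (by fun_prop)).aestronglyMeasurable
  · rw [Real.norm_eq_abs, abs_of_nonneg (poisK_nonneg hy _)]
    exact poisK_le hy _

lemma aux_re {f : ℝ → ℝ} (hf : Integrable f) (x : ℝ) {y : ℝ} (hy : 0 < y) :
    (cauchyTransform (fun t => (f t : ℂ)) ((x : ℂ) + (y : ℂ) * Complex.I)).re
      = ∫ t, f t * poisK y (x - t) := by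
  have hz : 0 < ((x : ℂ) + (y : ℂ) * Complex.I).im := by simpa using hy
  have hf2 : Integrable (fun t => (f t : ℂ)) := hf.ofReal
  have hi := (aux_integrand_integrable hf2 hz).const_mul (Complex.I * (Real.pi : ℂ))⁻¹
  unfold cauchyTransform
  rw [← integral_const_mul]
  have := integral_re hi
  simp only [RCLike.re_to_complex] at this
  refine this.symm.trans (integral_congr_ae (Filter.Eventually.of_forall fun t => ?_))
  have hpi := Real.pi_pos
  have hne : (t - x) ^ 2 + y ^ 2 ≠ 0 := by positivity
  have hne2 : (x - t) ^ 2 + y ^ 2 ≠ 0 := by positivity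
  have h1 : (Complex.I * (Real.pi : ℂ))⁻¹ * ((f t : ℂ) / ((t : ℂ) - ((x : ℂ) + (y : ℂ) * Complex.I)))
      = ((Real.pi⁻¹ * f t * ((t - x) ^ 2 + y ^ 2)⁻¹ : ℝ) : ℂ) * ((y : ℂ) - (t - x : ℝ) * Complex.I) := by
    have h3 : (Real.pi : ℂ) ≠ 0 := by exact_mod_cast hpi.ne'
    have h4 : (t : ℂ) - ((x : ℂ) + (y : ℂ) * Complex.I) ≠ 0 := by
      intro h
      have := congrArg Complex.im h
      simp at this
      exact hy.ne' this
    have h5 : ((t : ℂ) - x) ^ 2 + (y : ℂ) ^ 2 ≠ 0 := by exact_mod_cast hne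
    have hN : ((t : ℂ) - x) ^ 2 + (y : ℂ) ^ 2
        = ((t : ℂ) - ((x : ℂ) + (y : ℂ) * Complex.I)) * ((t : ℂ) - x + y * Complex.I) := by
      linear_combination (y : ℂ) ^ 2 * Complex.I_sq
    have hE : (y : ℂ) - ((t : ℂ) - x) * Complex.I = -Complex.I * ((t : ℂ) - x + y * Complex.I) := by
      linear_combination (y : ℂ) * Complex.I_sq
    push_cast
    rw [hE]
    rw [hN] at h5 ⊢
    rw [mul_inv, Complex.inv_I]
    have h6 := (mul_ne_zero_iff.1 h5).2
    revert h4 h6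
    generalize (t : ℂ) - ((x : ℂ) + (y : ℂ) * Complex.I) = D
    generalize (t : ℂ) - x + y * Complex.I = E
    generalize -Complex.I = J
    intro h4 h6
    field_simp
  beta_reduce
  rw [h1, Complex.re_ofReal_mul]
  simp [poisK]
  rw [show (x - t) ^ 2 = (t - x) ^ 2 by ring]
  ring

lemma aux_jensen {f : ℝ → ℝ} (hf0 : ∀ t, 0 ≤ f t) (hf : Integrable f)
    (hφ : Integrable (fun t => (1 + f t) * Real.log (1 + f t))) {y : ℝ} (hy : 0 < y) (x : ℝ) :
    (1 + ∫ t, f t * poisK y (x - t)) * Real.log (1 + ∫ t, f t * poisK y (x - t))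
      ≤ ∫ t, ((1 + f t) * Real.log (1 + f t)) * poisK y (x - t) := by
  set u := ∫ t, f t * poisK y (x - t) with hu
  have hu0 : 0 ≤ u := integral_nonneg fun t => mul_nonneg (hf0 t) (poisK_nonneg hy _)
  have hP : Integrable (fun t => poisK y (x - t)) := (poisK_integrable hy).comp_sub_left x
  have hP1 : ∫ t, poisK y (x - t) = 1 := by
    rw [integral_sub_left_eq_self (poisK y) volume x, poisK_integral hy]
  have hfP := poisK_mul_integrable hy hf x
  have hφP := poisK_mul_integrable hy hφ x
  have hpt : ∀ t, Real.log (1 + u) * (poisK y (x - t) + f t * poisK y (x - t))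
      ≤ ((1 + f t) * Real.log (1 + f t)) * poisK y (x - t)
        + (u * poisK y (x - t) - f t * poisK y (x - t)) := by
    intro t
    have hs := hf0 t
    have h1 : Real.log ((1 + u) / (1 + f t)) ≤ (1 + u) / (1 + f t) - 1 :=
      Real.log_le_sub_one_of_pos (by positivity)
    rw [Real.log_div (by positivity) (by positivity)] at h1
    have h2 : (1 + f t) * (Real.log (1 + u) - Real.log (1 + f t))
        ≤ (1 + f t) * ((1 + u) / (1 + f t) - 1) :=
      mul_le_mul_of_nonneg_left h1 (by positivity)
    have h3 : (1 + f t) * ((1 + u) / (1 + f t) - 1) = u - f t := by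
      have : 1 + f t ≠ 0 := by positivity
      field_simp
      ring
    have h4 := mul_le_mul_of_nonneg_right (h2.trans h3.le) (poisK_nonneg hy (x - t))
    nlinarith
  have hsub : Integrable (fun t => u * poisK y (x - t) - f t * poisK y (x - t)) :=
    (hP.const_mul u).sub hfP
  have hineq := integral_mono ((hP.add hfP).const_mul (Real.log (1 + u)))
    (hφP.add hsub) hpt
  simp only [Pi.add_apply] at hineq
  rw [integral_const_mul, integral_add hP hfP, integral_add hφP hsub,
    integral_sub (hP.const_mul u) hfP, integral_const_mul, hP1, ← hu] at hineq
  linarith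

lemma aux_conv_integrable {h : ℝ → ℝ} (hh : Integrable h) {y : ℝ} (hy : 0 < y) :
    Integrable (fun x => ∫ t, h t * poisK y (x - t)) :=
  hh.integrable_convolution (ContinuousLinearMap.mul ℝ ℝ) (poisK_integrable hy)

lemma aux_conv_integral {h : ℝ → ℝ} (hh : Integrable h) {y : ℝ} (hy : 0 < y) :
    ∫ x, ∫ t, h t * poisK y (x - t) = ∫ t, h t := by
  have := integral_convolution (ContinuousLinearMap.mul ℝ ℝ) (μ := volume) (ν := volume)
    hh (poisK_integrable hy)
  rw [poisK_integral hy] at this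
  simpa [convolution] using this

lemma aux_conv_le {h : ℝ → ℝ} (hh0 : ∀ t, 0 ≤ h t) (hh : Integrable h) {y : ℝ} (hy : 0 < y)
    {a b : ℝ} (hab : a ≤ b) :
    ∫ x in a..b, ∫ t, h t * poisK y (x - t) ≤ ∫ t, h t := by
  rw [intervalIntegral.integral_of_le hab, ← aux_conv_integral hh hy]
  exact setIntegral_le_integral (aux_conv_integrable hh hy)
    (Filter.Eventually.of_forall fun x =>
      integral_nonneg fun t => mul_nonneg (hh0 t) (poisK_nonneg hy _))

lemma aux_norm_wlog {w : ℂ} {B : ℝ} (hw : 1 ≤ w.re) (hB : ‖w‖ ≤ B) :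
    ‖w * Complex.log w‖ ≤ B * (B + Real.pi) := by
  have h1 : 1 ≤ ‖w‖ := hw.trans (Complex.re_le_norm w)
  have h2 : ‖Complex.log w‖ ≤ B + Real.pi := by
    refine (Complex.norm_le_abs_re_add_abs_im _).trans ?_
    rw [Complex.log_re, Complex.log_im, abs_of_nonneg (Real.log_nonneg h1)]
    have := Real.log_le_sub_one_of_pos (zero_lt_one.trans_le h1)
    have := Complex.abs_arg_le_pi w
    linarith
  rw [norm_mul]
  exact mul_le_mul hB h2 (norm_nonneg _) (by linarith)

lemma aux_continuous_line {g : ℝ → ℂ} (hg : Integrable g) {ε : ℝ} (hε : 0 < ε) :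
    Continuous (fun x : ℝ => cauchyTransform g ((x : ℂ) + (ε : ℂ) * Complex.I)) := by
  rw [continuous_iff_continuousAt]
  intro x
  have h1 : ContinuousAt (cauchyTransform g) ((x : ℂ) + (ε : ℂ) * Complex.I) :=
    (aux_differentiable hg (by simpa using hε)).continuousAt
  exact ContinuousAt.comp (f := fun x : ℝ => (x : ℂ) + (ε : ℂ) * Complex.I) h1
    (by fun_prop)

lemma aux_main {f : ℝ → ℝ} (hf0 : ∀ t, 0 ≤ f t) (hf : Integrable f)
    (hφ : Integrable (fun t => (1 + f t) * Real.log (1 + f t))) {L : ℝ} (hL : 0 < L)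
    (hsupp : Function.support f ⊆ Ioo (-(L / 2)) (L / 2)) :
    ∃ M : ℝ, ∀ ε : ℝ, 0 < ε → ∫ x in (-L)..L,
      ‖cauchyTransform (fun t => (f t : ℂ)) ((x : ℂ) + (ε : ℂ) * Complex.I)‖ ≤ M := by
  have hf2 : Integrable (fun t => (f t : ℂ)) := hf.ofReal
  set F := cauchyTransform (fun t => (f t : ℂ)) with hF
  have hsupp2 : Function.support (fun t => (f t : ℂ)) ⊆ Ioo (-(L / 2)) (L / 2) := by
    intro t ht
    exact hsupp (by simpa using ht)
  -- far bound
  set B : ℝ := 1 + (L / 2)⁻¹ * ∫ t, ‖(f t : ℂ)‖ with hB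
  have hfar : ∀ z : ℂ, (L / 2 ≤ |z.im| ∨ L ≤ |z.re|) → ‖1 + F z‖ ≤ B := by
    intro z hz
    refine (norm_add_le _ _).trans ?_
    rw [norm_one]
    suffices h : ‖F z‖ ≤ (L / 2)⁻¹ * ∫ t, ‖(f t : ℂ)‖ by linarith
    apply aux_bound hf2 (by positivity)
    intro t ht
    have ht' := hsupp2 ht
    rcases hz with hz | hz
    · refine hz.trans ?_
      simpa using Complex.abs_im_le_norm ((t : ℂ) - z)
    · have h1 := Complex.abs_re_le_norm ((t : ℂ) - z)
      simp only [Complex.sub_re, Complex.ofReal_re] at h1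
      have h2 : |z.re| ≤ |t - z.re| + |t| := by
        have := abs_sub_abs_le_abs_sub z.re t
        rw [abs_sub_comm] at this
        linarith
      have h3 : |t| ≤ L / 2 := abs_le.2 ⟨by linarith [ht'.1], by linarith [ht'.2]⟩
      linarith
  have hre : ∀ z : ℂ, 0 < z.im → 1 ≤ (1 + F z).re := by
    intro z hz
    have := aux_re hf z.re hz
    rw [Complex.re_add_im] at this
    rw [Complex.add_re, Complex.one_re, hF, this]
    have : 0 ≤ ∫ t, f t * poisK z.im (z.re - t) :=
      integral_nonneg fun t => mul_nonneg (hf0 t) (poisK_nonneg hz _)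
    linarith
  set H : ℂ → ℂ := fun z => (1 + F z) * Complex.log (1 + F z) with hH
  have hHd : ∀ z : ℂ, 0 < z.im → DifferentiableAt ℂ H z := by
    intro z hz
    have h1 : DifferentiableAt ℂ (fun z => 1 + F z) z := (aux_differentiable hf2 hz).const_add 1
    exact h1.mul (h1.clog (Or.inl (zero_lt_one.trans_le (hre z hz))))
  have hHfar : ∀ z : ℂ, 0 < z.im → (L / 2 ≤ |z.im| ∨ L ≤ |z.re|) →
      ‖H z‖ ≤ B * (B + Real.pi) := fun z hz hz2 => aux_norm_wlog (hre z hz) (hfar z hz2)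
  set K := B * (B + Real.pi) with hK
  set ψ : ℝ → ℝ := fun t => f t + (1 + f t) * Real.log (1 + f t) with hψ
  have hψi : Integrable ψ := hf.add hφ
  have hψ0 : ∀ t, 0 ≤ ψ t := fun t => by
    have := hf0 t
    have h2 : 0 ≤ Real.log (1 + f t) := Real.log_nonneg (by linarith)
    simp only [hψ]
    positivity
  refine ⟨2 * L + 4 * (2 * L + ∫ t, ψ t) + 4 * (4 * L * K), fun ε hε => ?_⟩
  -- contour integral
  have hrect := Complex.integral_boundary_rect_eq_zero_of_differentiableOn H
    ⟨-L, ε⟩ ⟨L, ε + L⟩ (by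
      intro z hz
      refine (hHd z ?_).differentiableWithinAt
      have := hz.2
      simp only [Set.mem_preimage] at this
      rw [Set.uIcc_of_le (by linarith)] at this
      linarith [this.1])
  simp only [] at hrect
  have hI1 : ‖∫ x in (-L)..L, H ((x : ℂ) + ((ε + L : ℝ) : ℂ) * Complex.I)‖ ≤ K * |L - -L| := by
    apply intervalIntegral.norm_integral_le_of_norm_le_const
    intro x _
    apply hHfar
    · simp; linarith
    · left
      simp only [Complex.add_im, Complex.ofReal_im, Complex.mul_im, Complex.ofReal_re,
        Complex.I_im, Complex.I_re, mul_one, mul_zero, add_zero, zero_add]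
      rw [abs_of_pos (by linarith)]; linarith
  have hIv : ∀ a : ℝ, |a| = L →
      ‖∫ y in ε..(ε + L), H ((a : ℂ) + (y : ℂ) * Complex.I)‖ ≤ K * |ε + L - ε| := by
    intro a ha
    apply intervalIntegral.norm_integral_le_of_norm_le_const
    intro y hy
    rw [Set.uIoc_of_le (by linarith)] at hy
    apply hHfar
    · simp; linarith [hy.1]
    · right
      simp [ha]
  have hI2 := hIv L (abs_of_pos hL)
  have hI3 := hIv (-L) (by rw [abs_neg, abs_of_pos hL])
  rw [show L - -L = 2 * L by ring, abs_of_pos (by positivity)] at hI1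
  rw [show ε + L - ε = L by ring, abs_of_pos hL] at hI2 hI3
  have hbot : ‖∫ x in (-L)..L, H ((x : ℂ) + (ε : ℂ) * Complex.I)‖ ≤ 4 * L * K := by
    have heq : ∫ x in (-L)..L, H ((x : ℂ) + (ε : ℂ) * Complex.I)
        = (∫ x in (-L)..L, H ((x : ℂ) + ((ε + L : ℝ) : ℂ) * Complex.I))
          - Complex.I • (∫ y in ε..(ε + L), H ((L : ℂ) + (y : ℂ) * Complex.I))
          + Complex.I • (∫ y in ε..(ε + L), H (((-L : ℝ) : ℂ) + (y : ℂ) * Complex.I)) := by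
      linear_combination hrect
    rw [heq]
    refine (norm_add_le _ _).trans ?_
    have := norm_sub_le (∫ x in (-L)..L, H ((x : ℂ) + ((ε + L : ℝ) : ℂ) * Complex.I))
      (Complex.I • (∫ y in ε..(ε + L), H ((L : ℂ) + (y : ℂ) * Complex.I)))
    rw [norm_smul, Complex.norm_I, one_mul] at this ⊢
    linarith
  have hcF : Continuous (fun x : ℝ => F ((x : ℂ) + (ε : ℂ) * Complex.I)) :=
    aux_continuous_line hf2 hε
  have hcH : Continuous (fun x : ℝ => H ((x : ℂ) + (ε : ℂ) * Complex.I)) := by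
    rw [continuous_iff_continuousAt]
    intro x
    exact ContinuousAt.comp (f := fun x : ℝ => (x : ℂ) + (ε : ℂ) * Complex.I)
      (hHd _ (by simpa using hε)).continuousAt (by fun_prop)
  have hpt : ∀ x : ℝ, ‖F ((x : ℂ) + (ε : ℂ) * Complex.I)‖
      ≤ (1 + 4 * (1 + ∫ t, ψ t * poisK ε (x - t)))
        - 4 * (H ((x : ℂ) + (ε : ℂ) * Complex.I)).re := by
    intro x
    have hz : 0 < ((x : ℂ) + (ε : ℂ) * Complex.I).im := by simpa using hε
    have h1 := aux_pointwise (1 + F ((x : ℂ) + (ε : ℂ) * Complex.I))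
      (zero_lt_one.trans_le (hre _ hz))
    have h2 : (1 + F ((x : ℂ) + (ε : ℂ) * Complex.I)).re = 1 + ∫ t, f t * poisK ε (x - t) := by
      rw [Complex.add_re, Complex.one_re, hF, aux_re hf x hε]
    rw [h2] at h1
    have h3 := aux_jensen hf0 hf hφ hε x
    have h4 : ∫ t, ψ t * poisK ε (x - t) = (∫ t, f t * poisK ε (x - t))
        + ∫ t, ((1 + f t) * Real.log (1 + f t)) * poisK ε (x - t) := by
      rw [← integral_add (poisK_mul_integrable hε hf x) (poisK_mul_integrable hε hφ x)]
      simp only [hψ, add_mul]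
    have h5 : ‖F ((x : ℂ) + (ε : ℂ) * Complex.I)‖
        ≤ ‖1 + F ((x : ℂ) + (ε : ℂ) * Complex.I)‖ + 1 := by
      have := norm_sub_le (1 + F ((x : ℂ) + (ε : ℂ) * Complex.I)) 1
      simpa using this
    rw [h4]
    simp only [hH]
    linarith
  have hci : IntervalIntegrable (fun x => ∫ t, ψ t * poisK ε (x - t)) volume (-L) L :=
    (aux_conv_integrable hψi hε).intervalIntegrable
  have hcc : IntervalIntegrable (fun _ : ℝ => (1 : ℝ)) volume (-L) L := intervalIntegrable_const
  have hci2 : IntervalIntegrable (fun x => 1 + 4 * (1 + ∫ t, ψ t * poisK ε (x - t)))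
      volume (-L) L := hcc.add ((hcc.add hci).const_mul 4)
  have hHre : IntervalIntegrable (fun x : ℝ => 4 * (H ((x : ℂ) + (ε : ℂ) * Complex.I)).re)
      volume (-L) L := (continuous_const.mul (Complex.continuous_re.comp hcH)).intervalIntegrable _ _
  have hmono := intervalIntegral.integral_mono_on (by linarith : -L ≤ L)
    (hcF.norm.intervalIntegrable (μ := volume) _ _) (hci2.sub hHre) (fun x _ => hpt x)
  refine hmono.trans ?_
  rw [intervalIntegral.integral_sub hci2 hHre,
    intervalIntegral.integral_add hcc ((hcc.add hci).const_mul 4),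
    intervalIntegral.integral_const_mul, intervalIntegral.integral_add hcc hci,
    intervalIntegral.integral_const_mul, intervalIntegral.integral_const]
  have hconv := aux_conv_le hψ0 hψi hε (by linarith : -L ≤ L)
  have hreI : ∫ x in (-L)..L, (H ((x : ℂ) + (ε : ℂ) * Complex.I)).re
      = (∫ x in (-L)..L, H ((x : ℂ) + (ε : ℂ) * Complex.I)).re := by
    have := Complex.reCLM.intervalIntegral_comp_comm
      (hcH.intervalIntegrable (μ := volume) (-L) L)
    simpa using this
  rw [hreI]
  have habs := (Complex.abs_re_le_norm _).trans hbot
  have := neg_le_of_abs_le habs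
  simp only [smul_eq_mul, mul_one]
  linarith

lemma aux_part {g : ℝ → ℂ}
    (hG : Integrable (fun t => ‖g t‖ * (1 + logPlus ‖g t‖))) (hg : Integrable g)
    {L : ℝ} (hL : 0 < L) (hsupp : Function.support g ⊆ Ioo (-(L / 2)) (L / 2))
    {f : ℝ → ℝ} (hfm : Measurable f) (hf0 : ∀ t, 0 ≤ f t) (hfg : ∀ t, f t ≤ ‖g t‖) :
    Integrable f ∧ ∃ M : ℝ, ∀ ε : ℝ, 0 < ε → ∫ x in (-L)..L,
      ‖cauchyTransform (fun t => (f t : ℂ)) ((x : ℂ) + (ε : ℂ) * Complex.I)‖ ≤ M := by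
  have hf : Integrable f := by
    refine hg.mono hfm.aestronglyMeasurable (Filter.Eventually.of_forall fun t => ?_)
    rw [Real.norm_eq_abs, abs_of_nonneg (hf0 t)]
    exact hfg t
  refine ⟨hf, aux_main hf0 hf ?_ hL ?_⟩
  · refine (hG.const_mul 2).mono' ?_ (Filter.Eventually.of_forall fun t => ?_)
    · exact ((measurable_const.add hfm).mul
        (measurable_const.add hfm).log).aestronglyMeasurable
    · have h0 := hf0 t
      have h1 := hfg t
      have hl0 : 0 ≤ Real.log (1 + f t) := Real.log_nonneg (by linarith)
      rw [Real.norm_eq_abs, abs_of_nonneg (by positivity)]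
      have hl1 : Real.log (1 + f t) ≤ f t := by
        have := Real.log_le_sub_one_of_pos (by linarith : 0 < 1 + f t)
        linarith
      have hm : (0 : ℝ) < max ‖g t‖ 1 := lt_max_of_lt_right one_pos
      have hl2 : Real.log (1 + f t) ≤ Real.log 2 + logPlus ‖g t‖ := by
        unfold logPlus
        rw [← Real.log_mul two_ne_zero hm.ne']
        apply Real.log_le_log (by linarith)
        have := le_max_left ‖g t‖ 1
        have := le_max_right ‖g t‖ 1
        linarith
      have hl3 : 0 ≤ logPlus ‖g t‖ := Real.log_nonneg (le_max_right _ _)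
      have hl4 : Real.log 2 < 1 := by linarith [Real.log_two_lt_d9]
      have hl5 : f t * Real.log (1 + f t) ≤ ‖g t‖ * (1 + logPlus ‖g t‖) :=
        mul_le_mul h1 (by linarith) hl0 (norm_nonneg _)
      have hl6 : 0 ≤ ‖g t‖ * logPlus ‖g t‖ := by positivity
      nlinarith
  · intro t ht
    apply hsupp
    intro h
    have h1 := hfg t
    rw [h, norm_zero] at h1
    exact ht (le_antisymm h1 (hf0 t))

lemma aux_side {g : ℝ → ℂ} (hg : Integrable g) {d : ℝ} (hd : 0 < d) {γ : ℝ → ℂ} {a b : ℝ}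
    (hab : a ≤ b)
    (h : ∀ s ∈ Icc a b, ∀ t ∈ Function.support g, d ≤ ‖(t : ℂ) - γ s‖) :
    ∫ s in a..b, ‖cauchyTransform g (γ s)‖ ≤ (d⁻¹ * ∫ t, ‖g t‖) * (b - a) := by
  have := intervalIntegral.norm_integral_le_of_norm_le_const
    (f := fun s => ‖cauchyTransform g (γ s)‖) (a := a) (b := b) (C := d⁻¹ * ∫ t, ‖g t‖) (by
      intro s hs
      rw [Set.uIoc_of_le hab] at hs
      rw [norm_norm]
      exact aux_bound hg hd (h s (Ioc_subset_Icc_self hs)))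
  rw [abs_of_nonneg (by linarith : 0 ≤ b - a)] at this
  exact (Real.le_norm_self _).trans this

lemma aux_sum4 {k k1 k2 k3 k4 : ℝ → ℝ} (h : Continuous k) (h1 : Continuous k1)
    (h2 : Continuous k2) (h3 : Continuous k3) (h4 : Continuous k4) {a b : ℝ} (hab : a ≤ b)
    (hle : ∀ x, k x ≤ k1 x + k2 x + (k3 x + k4 x)) :
    ∫ x in a..b, k x ≤ (∫ x in a..b, k1 x) + (∫ x in a..b, k2 x)
      + ((∫ x in a..b, k3 x) + ∫ x in a..b, k4 x) := by
  have h12 : Continuous (fun x => k1 x + k2 x) := h1.add h2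
  have h34 : Continuous (fun x => k3 x + k4 x) := h3.add h4
  rw [← intervalIntegral.integral_add (h1.intervalIntegrable _ _) (h2.intervalIntegrable _ _),
    ← intervalIntegral.integral_add (h3.intervalIntegrable _ _) (h4.intervalIntegrable _ _),
    ← intervalIntegral.integral_add (h12.intervalIntegrable _ _) (h34.intervalIntegrable _ _)]
  exact intervalIntegral.integral_mono_on hab (h.intervalIntegrable _ _)
    ((h12.add h34).intervalIntegrable _ _) (fun x _ => hle x)

/-- For `g ∈ L log⁺ L` supported in `(−L/2, L/2)`, the Cauchy transform belongs to the
Smirnov class `E¹(Ω_L)`: it is holomorphic on `Ω_L` and its arclength integrals over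
the concentric square contours `Q_ε`, `0 < ε < L/2`, are uniformly bounded. -/
theorem cauchyTransform_smirnov_E1
    (g : ℝ → ℂ) (hmeas : Measurable g)
    (hLlogL : ∫⁻ t : ℝ, ENNReal.ofReal (‖g t‖ * (1 + logPlus ‖g t‖)) < ⊤)
    (L : ℝ) (hL : 0 < L) (hsupp : Function.support g ⊆ Ioo (-(L / 2)) (L / 2)) :
    DifferentiableOn ℂ (cauchyTransform g) (SquareOmega L) ∧
    ∃ M : ℝ, ∀ ε ∈ Ioo (0 : ℝ) (L / 2), contourInt g L ε ≤ M := by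
  have hlp : ∀ t, 0 ≤ logPlus ‖g t‖ := fun t => Real.log_nonneg (le_max_right _ _)
  have hnn : ∀ t, 0 ≤ ‖g t‖ * (1 + logPlus ‖g t‖) := fun t => by
    have := hlp t
    positivity
  have hG : Integrable (fun t => ‖g t‖ * (1 + logPlus ‖g t‖)) := by
    refine ⟨?_, ?_⟩
    · have : Measurable (fun t => ‖g t‖ * (1 + logPlus ‖g t‖)) := by
        unfold logPlus
        exact hmeas.norm.mul (measurable_const.add (hmeas.norm.max measurable_const).log)
      exact this.aestronglyMeasurable
    · rw [hasFiniteIntegral_iff_ofReal (Filter.Eventually.of_forall hnn)]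
      exact hLlogL
  have hg : Integrable g := by
    refine hG.mono' hmeas.aestronglyMeasurable (Filter.Eventually.of_forall fun t => ?_)
    nlinarith [norm_nonneg (g t), hlp t, mul_nonneg (norm_nonneg (g t)) (hlp t)]
  refine ⟨fun z hz => (aux_differentiable hg hz.2.2.1).differentiableWithinAt, ?_⟩
  have hre := Complex.measurable_re.comp hmeas
  have him := Complex.measurable_im.comp hmeas
  obtain ⟨h1, M1, hM1⟩ := aux_part hG hg hL hsupp (f := fun t => max (g t).re 0)
    (hre.max measurable_const) (fun t => le_max_right _ _)
    (fun t => max_le (Complex.re_le_norm _) (norm_nonneg _))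
  obtain ⟨h2, M2, hM2⟩ := aux_part hG hg hL hsupp (f := fun t => max (-(g t).re) 0)
    (hre.neg.max measurable_const) (fun t => le_max_right _ _)
    (fun t => max_le ((neg_le_abs _).trans (Complex.abs_re_le_norm _)) (norm_nonneg _))
  obtain ⟨h3, M3, hM3⟩ := aux_part hG hg hL hsupp (f := fun t => max (g t).im 0)
    (him.max measurable_const) (fun t => le_max_right _ _)
    (fun t => max_le (Complex.im_le_norm _) (norm_nonneg _))
  obtain ⟨h4, M4, hM4⟩ := aux_part hG hg hL hsupp (f := fun t => max (-(g t).im) 0)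
    (him.neg.max measurable_const) (fun t => le_max_right _ _)
    (fun t => max_le ((neg_le_abs _).trans (Complex.abs_im_le_norm _)) (norm_nonneg _))
  set f1 : ℝ → ℝ := fun t => max (g t).re 0
  set f2 : ℝ → ℝ := fun t => max (-(g t).re) 0
  set f3 : ℝ → ℝ := fun t => max (g t).im 0
  set f4 : ℝ → ℝ := fun t => max (-(g t).im) 0
  have c1 : Integrable (fun t => (f1 t : ℂ)) := h1.ofReal
  have c2 : Integrable (fun t => (f2 t : ℂ)) := h2.ofReal
  have c3 : Integrable (fun t => (f3 t : ℂ)) := h3.ofReal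
  have c4 : Integrable (fun t => (f4 t : ℂ)) := h4.ofReal
  have hdec : ∀ t, g t = ((f1 t : ℂ) - f2 t) + Complex.I * ((f3 t : ℂ) - f4 t) := by
    intro t
    have aux : ∀ x : ℝ, max x 0 - max (-x) 0 = x := fun x => by
      rcases le_total x 0 with h | h
      · rw [max_eq_right h, max_eq_left (by linarith)]; ring
      · rw [max_eq_left h, max_eq_right (by linarith)]; ring
    rw [← Complex.ofReal_sub, ← Complex.ofReal_sub, aux, aux, mul_comm, Complex.re_add_im]
  have hsplit : ∀ z : ℂ, 0 < z.im → cauchyTransform g z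
      = (cauchyTransform (fun t => (f1 t : ℂ)) z - cauchyTransform (fun t => (f2 t : ℂ)) z)
        + Complex.I * (cauchyTransform (fun t => (f3 t : ℂ)) z
          - cauchyTransform (fun t => (f4 t : ℂ)) z) := by
    intro z hz
    have i1 := aux_integrand_integrable c1 hz
    have i2 := aux_integrand_integrable c2 hz
    have i3 := aux_integrand_integrable c3 hz
    have i4 := aux_integrand_integrable c4 hz
    have i12 : Integrable (fun t : ℝ => (f1 t : ℂ) / ((t : ℂ) - z) - (f2 t : ℂ) / ((t : ℂ) - z)) :=
      i1.sub i2
    have i34 : Integrable (fun t : ℝ => Complex.I *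
        ((f3 t : ℂ) / ((t : ℂ) - z) - (f4 t : ℂ) / ((t : ℂ) - z))) := (i3.sub i4).const_mul _
    have e : ∫ t, g t / ((t : ℂ) - z)
        = ((∫ t, (f1 t : ℂ) / ((t : ℂ) - z)) - ∫ t, (f2 t : ℂ) / ((t : ℂ) - z))
          + Complex.I * ((∫ t, (f3 t : ℂ) / ((t : ℂ) - z)) - ∫ t, (f4 t : ℂ) / ((t : ℂ) - z)) := by
      rw [← integral_sub i1 i2, ← integral_sub i3 i4, ← integral_const_mul,
        ← integral_add i12 i34]
      refine integral_congr_ae (Filter.Eventually.of_forall fun t => ?_)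
      beta_reduce
      rw [hdec t]
      ring
    unfold cauchyTransform
    rw [e]
    ring
  set N := ∫ t, ‖g t‖ with hN
  have hN0 : 0 ≤ N := integral_nonneg fun t => norm_nonneg _
  set A := (L / 4)⁻¹ * N with hA
  have hA0 : 0 ≤ A := by positivity
  refine ⟨(M1 + M2 + M3 + M4) + 3 * (A * (2 * L)), fun ε hε => ?_⟩
  obtain ⟨he0, he1⟩ := hε
  have hlin := @aux_continuous_line
  have k := (hlin hg he0).norm
  have k1 := (hlin c1 he0).norm
  have k2 := (hlin c2 he0).norm
  have k3 := (hlin c3 he0).norm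
  have k4 := (hlin c4 he0).norm
  -- bottom side
  have hb : ∫ x in (-L + ε)..(L - ε), ‖cauchyTransform g ((x : ℂ) + (ε : ℂ) * Complex.I)‖
      ≤ M1 + M2 + M3 + M4 := by
    have s1 : ∫ x in (-L + ε)..(L - ε), ‖cauchyTransform g ((x : ℂ) + (ε : ℂ) * Complex.I)‖
        ≤ ∫ x in (-L)..L, ‖cauchyTransform g ((x : ℂ) + (ε : ℂ) * Complex.I)‖ :=
      intervalIntegral.integral_mono_interval (by linarith) (by linarith) (by linarith)
        (Filter.Eventually.of_forall fun x => norm_nonneg _) (k.intervalIntegrable _ _)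
    have s2 := aux_sum4 k k1 k2 k3 k4 (by linarith : -L ≤ L)
      (fun x => by
        rw [hsplit _ (by simpa using he0)]
        refine (norm_add_le _ _).trans ?_
        rw [norm_mul, Complex.norm_I, one_mul]
        have q1 := norm_sub_le
          (cauchyTransform (fun t => (f1 t : ℂ)) ((x : ℂ) + (ε : ℂ) * Complex.I))
          (cauchyTransform (fun t => (f2 t : ℂ)) ((x : ℂ) + (ε : ℂ) * Complex.I))
        have q2 := norm_sub_le
          (cauchyTransform (fun t => (f3 t : ℂ)) ((x : ℂ) + (ε : ℂ) * Complex.I))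
          (cauchyTransform (fun t => (f4 t : ℂ)) ((x : ℂ) + (ε : ℂ) * Complex.I))
        linarith)
    linarith [hM1 ε he0, hM2 ε he0, hM3 ε he0, hM4 ε he0]
  have hlen : A * (L - ε - (-L + ε)) ≤ A * (2 * L) :=
    mul_le_mul_of_nonneg_left (by linarith) hA0
  have hlen2 : A * (2 * L - ε - ε) ≤ A * (2 * L) :=
    mul_le_mul_of_nonneg_left (by linarith) hA0
  have ht := aux_side hg (by positivity : 0 < L / 4)
    (γ := fun x : ℝ => (x : ℂ) + ((2 * L - ε : ℝ) : ℂ) * Complex.I)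
    (by linarith : -L + ε ≤ L - ε) (by
      intro s _ t _
      refine le_trans ?_ (Complex.abs_im_le_norm _)
      simp only [Complex.sub_im, Complex.add_im, Complex.ofReal_im, Complex.mul_im,
        Complex.ofReal_re, Complex.I_im, Complex.I_re, mul_one, mul_zero, add_zero, zero_add,
        zero_sub, abs_neg]
      exact le_trans (by linarith) (le_abs_self _))
  have hv : ∀ a : ℝ, |a| = L - ε → ∫ y in ε..(2 * L - ε),
      ‖cauchyTransform g ((a : ℂ) + (y : ℂ) * Complex.I)‖ ≤ A * (2 * L - ε - ε) := by
    intro a ha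
    refine aux_side hg (by positivity : 0 < L / 4)
      (γ := fun y : ℝ => (a : ℂ) + (y : ℂ) * Complex.I) (by linarith) ?_
    intro y hy t ht
    by_cases hc : L / 4 ≤ ε
    · refine le_trans ?_ (Complex.abs_im_le_norm _)
      simp only [Complex.sub_im, Complex.add_im, Complex.ofReal_im, Complex.mul_im,
        Complex.ofReal_re, Complex.I_im, Complex.I_re, mul_one, mul_zero, add_zero, zero_add,
        zero_sub, abs_neg]
      exact le_trans (by linarith [hy.1]) (le_abs_self _)
    · refine le_trans ?_ (Complex.abs_re_le_norm _)
      simp only [Complex.sub_re, Complex.add_re, Complex.ofReal_im, Complex.mul_re,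
        Complex.ofReal_re, Complex.I_im, Complex.I_re, mul_one, mul_zero, add_zero, sub_zero]
      have ht' := hsupp ht
      have q : |t| ≤ L / 2 := abs_le.2 ⟨by linarith [ht'.1], by linarith [ht'.2]⟩
      have q2 := abs_sub_abs_le_abs_sub a t
      rw [abs_sub_comm] at q2
      linarith
  have hr := hv (L - ε) (abs_of_pos (by linarith))
  have hl := hv (-L + ε) (by rw [abs_of_neg (by linarith)]; ring)
  unfold contourInt
  rw [← hN, ← hA] at ht
  linarith

end
end

section
/- (Hardy–Littlewood) There exists a constant C > 0 such that for every holomorphic function f on the unit disc 𝔻 = {z ∈ ℂ : |z| < 1}, one has ∫_𝔻 |f(z)|² dA(z) ≤ C · (sup_{0 < r < 1} (1/(2π)) ∫₀^{2π} |f(r e^{iθ})| dθ)². In particular the Hardy space H¹(𝔻) embeds continuously into the Bergman space A²(𝔻). -/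
open MeasureTheory Set

noncomputable section

lemma HL_S (d : ℕ → ℂ) (hd : Summable fun n => ‖d n‖) (H : ℝ → ℂ) (hH : Continuous H) :
    HasSum (fun n : ℕ => d n * ∫ t in (0:ℝ)..(2*Real.pi), H t * Complex.exp ((n:ℂ) * t * Complex.I))
      (∫ t in (0:ℝ)..(2*Real.pi), H t * ∑' n : ℕ, d n * Complex.exp ((n:ℂ) * t * Complex.I)) := by
  have hn : ∀ (n : ℕ) (t : ℝ), ‖Complex.exp ((n:ℂ) * t * Complex.I)‖ = 1 := by
    intro n t
    have := Complex.norm_exp_ofReal_mul_I ((n:ℝ)*t)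
    simpa using this
  obtain ⟨B, hB⟩ := (isCompact_Icc (a := (0:ℝ)) (b := 2*Real.pi)).exists_bound_of_continuousOn hH.continuousOn
  have key := intervalIntegral.hasSum_integral_of_dominated_convergence (μ := volume)
    (a := (0:ℝ)) (b := 2*Real.pi)
    (F := fun (n : ℕ) (t : ℝ) => H t * (d n * Complex.exp ((n:ℂ) * t * Complex.I)))
    (f := fun t => H t * ∑' n : ℕ, d n * Complex.exp ((n:ℂ) * t * Complex.I))
    (fun n _ => B * ‖d n‖) ?_ ?_ ?_ ?_ ?_
  · suffices e : (fun n : ℕ => d n * ∫ t in (0:ℝ)..(2*Real.pi), H t * Complex.exp ((n:ℂ) * t * Complex.I))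
        = fun n : ℕ => ∫ t in (0:ℝ)..(2*Real.pi), H t * (d n * Complex.exp ((n:ℂ) * t * Complex.I)) by
      rw [e]; exact key
    ext n
    rw [← intervalIntegral.integral_const_mul]
    congr 1; ext t; ring
  · intro n; apply Continuous.aestronglyMeasurable; fun_prop
  · intro n; filter_upwards with t ht
    rw [norm_mul, norm_mul, hn, mul_one]
    rw [uIoc_of_le (by positivity)] at ht
    exact mul_le_mul_of_nonneg_right (hB t ⟨ht.1.le, ht.2⟩) (norm_nonneg _)
  · filter_upwards with t _ using hd.mul_left B
  · simp
  · filter_upwards with t _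
    apply HasSum.mul_left
    apply Summable.hasSum
    apply Summable.of_norm
    simpa [hn] using hd

lemma HL_cont (d : ℕ → ℂ) (hd : Summable fun n => ‖d n‖) :
    Continuous (fun t : ℝ => ∑' n : ℕ, d n * Complex.exp ((n:ℂ) * t * Complex.I)) := by
  apply continuous_tsum (u := fun n => ‖d n‖) _ hd
  · intro n t
    have := Complex.norm_exp_ofReal_mul_I ((n:ℝ)*t)
    push_cast at this
    rw [norm_mul, this, mul_one]
  · intro n; fun_prop

lemma HL_per (d : ℕ → ℂ) :
    Function.Periodic (fun t : ℝ => ∑' n : ℕ, d n * Complex.exp ((n:ℂ) * t * Complex.I)) (2*Real.pi) := by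
  intro t
  simp only
  congr 1; ext n; congr 1
  rw [Complex.exp_eq_exp_iff_exists_int]
  exact ⟨n, by push_cast; ring⟩

lemma HL_int (m : ℤ) (hm : m ≠ 0) :
    ∫ t in (0:ℝ)..(2*Real.pi), Complex.exp ((m:ℂ) * t * Complex.I) = 0 := by
  have h := integral_exp_mul_complex (a := 0) (b := 2*Real.pi) (c := (m:ℂ) * Complex.I)
    (by simp [hm])
  have e : ∀ t : ℝ, (m:ℂ) * t * Complex.I = (m:ℂ) * Complex.I * t := fun t => by ring
  simp_rw [e, h]
  have : Complex.exp ((m:ℂ) * Complex.I * ((2*Real.pi : ℝ):ℂ)) = 1 := by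
    rw [Complex.exp_eq_one_iff]; exact ⟨m, by push_cast; ring⟩
  rw [this]; simp

lemma HL_K (m : ℕ) :
    ∫ t in (0:ℝ)..(2*Real.pi), (Complex.I * ((t:ℂ) - Real.pi) * Complex.exp (t * Complex.I))
      * Complex.exp ((m:ℂ) * t * Complex.I) = 2 * Real.pi / (m + 1) := by
  have hm : (m:ℂ) + 1 ≠ 0 := by exact_mod_cast Nat.succ_ne_zero m
  have hd : ∀ t : ℝ, HasDerivAt (fun t : ℝ => ((t:ℂ) - Real.pi) / (m+1) * Complex.exp ((m+1) * t * Complex.I)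
      - Complex.exp ((m+1) * t * Complex.I) / ((m+1)^2 * Complex.I))
      ((Complex.I * ((t:ℂ) - Real.pi) * Complex.exp (t * Complex.I))
      * Complex.exp ((m:ℂ) * t * Complex.I)) t := by
    intro t
    have h1 : HasDerivAt (fun t : ℝ => (t:ℂ)) 1 t := Complex.ofRealCLM.hasDerivAt
    have h2 := ((h1.const_mul ((m:ℂ)+1)).mul_const Complex.I).cexp
    refine HasDerivAt.congr_deriv ((((h1.sub_const (Real.pi:ℂ)).div_const ((m:ℂ)+1)).mul h2).sub
      (h2.div_const (((m:ℂ)+1)^2 * Complex.I))) ?_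
    have : Complex.exp ((m+1) * t * Complex.I) = Complex.exp (t * Complex.I) * Complex.exp ((m:ℂ) * t * Complex.I) := by
      rw [← Complex.exp_add]; congr 1; ring
    rw [this]
    field_simp
    ring
  rw [intervalIntegral.integral_eq_sub_of_hasDerivAt (fun t _ => hd t)
    (Continuous.intervalIntegrable (by fun_prop) _ _)]
  have : Complex.exp (((m:ℂ)+1) * ((2*Real.pi : ℝ):ℂ) * Complex.I) = 1 := by
    rw [Complex.exp_eq_one_iff]; exact ⟨m+1, by push_cast; ring⟩
  rw [this]
  simp
  field_simp
  ring

/-- coefficient formula -/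
lemma HL_coef (c : ℕ → ℂ) (hc : Summable fun n => ‖c n‖) (n : ℕ) :
    ∫ t in (0:ℝ)..(2*Real.pi), (starRingEnd ℂ) (∑' k : ℕ, c k * Complex.exp ((k:ℂ) * t * Complex.I))
      * Complex.exp ((n:ℂ) * t * Complex.I) = 2 * Real.pi * (starRingEnd ℂ) (c n) := by
  have h := HL_S c hc (fun t => Complex.exp (-(n:ℂ) * t * Complex.I)) (by fun_prop)
  have e : ∀ k : ℕ, ∫ t in (0:ℝ)..(2*Real.pi), Complex.exp (-(n:ℂ) * t * Complex.I) *
      Complex.exp ((k:ℂ) * t * Complex.I) = if k = n then 2 * Real.pi else 0 := by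
    intro k
    have : ∀ t : ℝ, Complex.exp (-(n:ℂ) * t * Complex.I) * Complex.exp ((k:ℂ) * t * Complex.I)
        = Complex.exp ((((k:ℤ) - n : ℤ):ℂ) * t * Complex.I) := by
      intro t; rw [← Complex.exp_add]; congr 1; push_cast; ring
    simp_rw [this]
    split_ifs with hk
    · subst hk; simp
    · exact HL_int _ (by omega)
  simp_rw [e] at h
  have h2 := h.unique (hasSum_single n (by intro k hk; simp [hk]))
  simp only [if_true] at h2
  have h3 := congrArg (starRingEnd ℂ) h2
  rw [intervalIntegral.integral_of_le (by positivity), ← integral_conj,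
    ← intervalIntegral.integral_of_le (by positivity)] at h3
  simp only [map_mul, ← Complex.exp_conj] at h3
  simp at h3
  rw [mul_comm ((starRingEnd ℂ) (c n))] at h3
  have h4 : (starRingEnd ℂ) 2 = 2 := Complex.conj_ofNat 2
  rw [h4] at h3
  rw [← h3]
  congr 1; ext t; rw [mul_comm]

lemma HL_pars (c d : ℕ → ℂ) (hc : Summable fun n => ‖c n‖) (hd : Summable fun n => ‖d n‖) :
    HasSum (fun n => 2 * Real.pi * (d n * (starRingEnd ℂ) (c n)))
      (∫ t in (0:ℝ)..(2*Real.pi), (starRingEnd ℂ) (∑' k : ℕ, c k * Complex.exp ((k:ℂ) * t * Complex.I))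
      * ∑' k : ℕ, d k * Complex.exp ((k:ℂ) * t * Complex.I)) := by
  have h := HL_S d hd _ (Complex.continuous_conj.comp (HL_cont c hc))
  simp only [Function.comp_apply, HL_coef c hc] at h
  convert h using 2 with n
  ring

lemma HL_pars2 (c : ℕ → ℂ) (hc : Summable fun n => ‖c n‖) :
    HasSum (fun n => 2 * Real.pi * ‖c n‖^2)
      (∫ t in (0:ℝ)..(2*Real.pi), ‖∑' k : ℕ, c k * Complex.exp ((k:ℂ) * t * Complex.I)‖^2) := by
  have h := HL_pars c c hc hc
  simp only [Complex.mul_conj', Complex.conj_mul'] at h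
  rw [← Complex.hasSum_ofReal, ← intervalIntegral.integral_ofReal]
  exact_mod_cast h

lemma HL_main (c : ℕ → ℂ) (hc : Summable fun n => ‖c n‖) (N : ℕ) :
    ∑ n ∈ Finset.range N, ‖c n‖^2 / (n+1) ≤ Real.pi * ((2*Real.pi)⁻¹ *
      ∫ t in (0:ℝ)..(2*Real.pi), ‖∑' k : ℕ, c k * Complex.exp ((k:ℂ) * t * Complex.I)‖)^2 := by
  set F := fun t : ℝ => ∑' k : ℕ, c k * Complex.exp ((k:ℂ) * t * Complex.I) with hF
  have hFc : Continuous F := HL_cont c hc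
  have hFp : Function.Periodic F (2*Real.pi) := HL_per c
  set d : ℕ → ℂ := fun n => c n / (n+1) with hd
  have hdn : ∀ n, ‖d n‖ = ‖c n‖ / (n+1) := by
    intro n
    have : ‖(n:ℂ)+1‖ = n+1 := by exact_mod_cast Complex.norm_natCast (n+1)
    rw [hd]; simp only; rw [norm_div, this]
  have hds : Summable fun n => ‖d n‖ := by
    refine hc.of_nonneg_of_le (fun n => norm_nonneg _) (fun n => ?_)
    rw [hdn]
    exact div_le_self (norm_nonneg _) (by simp)
  set G := fun t : ℝ => ∑' k : ℕ, d k * Complex.exp ((k:ℂ) * t * Complex.I) with hG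
  have hGF : ∀ s : ℝ, 2 * Real.pi * G s = ∫ t in (0:ℝ)..(2*Real.pi),
      (Complex.I * ((t:ℂ) - Real.pi) * Complex.exp (t * Complex.I)) * F (t + s) := by
    intro s
    have hnn : ∀ n : ℕ, ‖Complex.exp ((n:ℂ) * s * Complex.I)‖ = 1 := fun n => by
      simpa using Complex.norm_exp_ofReal_mul_I ((n:ℝ)*s)
    have h := HL_S (fun n => c n * Complex.exp ((n:ℂ) * s * Complex.I)) (by simpa [hnn] using hc)
      (fun t => Complex.I * ((t:ℂ) - Real.pi) * Complex.exp (t * Complex.I)) (by fun_prop)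
    simp only [HL_K] at h
    have e : ∀ t : ℝ, F (t+s) = ∑' n : ℕ, c n * Complex.exp ((n:ℂ) * s * Complex.I) * Complex.exp ((n:ℂ) * t * Complex.I) := by
      intro t; simp only [hF]; congr 1; ext n
      rw [mul_assoc (c n), ← Complex.exp_add]; congr 2; push_cast; ring
    simp only [e]
    rw [← h.tsum_eq, hG, ← tsum_mul_left]
    congr 1; ext n; simp only [hd]; ring
  set A := ∫ t in (0:ℝ)..(2*Real.pi), ‖F t‖ with hA
  have hA0 : 0 ≤ A := intervalIntegral.integral_nonneg (by positivity) (fun _ _ => norm_nonneg _)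
  have hGb : ∀ s, ‖G s‖ ≤ A / 2 := by
    intro s
    have h1 : ‖2 * (Real.pi:ℂ) * G s‖ ≤ Real.pi * A := by
      rw [hGF s]
      have hper : ∫ t in (0:ℝ)..(2*Real.pi), ‖F (t+s)‖ = A := by
        rw [intervalIntegral.integral_comp_add_right (fun t => ‖F t‖) s, hA]
        have hp : Function.Periodic (fun t => ‖F t‖) (2*Real.pi) := hFp.comp _
        have := hp.intervalIntegral_add_eq s 0
        rw [zero_add, add_comm (2*Real.pi) s, this, zero_add]
      rw [← hper, ← intervalIntegral.integral_const_mul]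
      apply intervalIntegral.norm_integral_le_of_norm_le (by positivity)
      · filter_upwards with t ht
        have : ‖(t:ℂ) - Real.pi‖ ≤ Real.pi := by
          rw [← Complex.ofReal_sub, Complex.norm_real, Real.norm_eq_abs, abs_le]
          constructor <;> linarith [ht.1, ht.2]
        rw [norm_mul, norm_mul, norm_mul, Complex.norm_exp_ofReal_mul_I, Complex.norm_I, one_mul, mul_one]
        gcongr
      · exact Continuous.intervalIntegrable (by fun_prop) _ _
    rw [norm_mul, norm_mul, Complex.norm_real, Real.norm_of_nonneg Real.pi_pos.le] at h1
    simp only [Complex.norm_ofNat] at h1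
    have := Real.pi_pos
    nlinarith
  have hP := HL_pars c d hc hds
  have hPr : HasSum (fun n : ℕ => 2 * Real.pi * (‖c n‖^2 / (n+1)))
    (∫ t in (0:ℝ)..(2*Real.pi), (starRingEnd ℂ) (F t) * G t).re := by
    convert Complex.hasSum_re hP using 2 with n
    have : 2 * (Real.pi:ℂ) * (d n * (starRingEnd ℂ) (c n)) = ((2 * Real.pi * (‖c n‖^2 / (n+1)) : ℝ):ℂ) := by
      simp only [hd]
      rw [div_mul_eq_mul_div, Complex.mul_conj']
      push_cast; ring
    rw [this, Complex.ofReal_re]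
  have hle : (∫ t in (0:ℝ)..(2*Real.pi), (starRingEnd ℂ) (F t) * G t).re ≤ A * (A/2) := by
    refine (Complex.re_le_norm _).trans ?_
    nth_rewrite 1 [hA]
    rw [← intervalIntegral.integral_mul_const]
    apply intervalIntegral.norm_integral_le_of_norm_le (by positivity)
    · filter_upwards with t ht
      rw [norm_mul, RCLike.norm_conj]
      exact mul_le_mul_of_nonneg_left (hGb t) (norm_nonneg _)
    · exact Continuous.intervalIntegrable (by fun_prop) _ _
  have h3 := (sum_le_hasSum (Finset.range N) (fun n _ => by positivity) hPr).trans hle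
  rw [← Finset.mul_sum] at h3
  have hpi := Real.pi_pos
  have e : Real.pi * ((2*Real.pi)⁻¹ * A)^2 = (2*Real.pi)⁻¹ * (A * (A/2)) := by
    field_simp
    try ring
  rw [e, inv_mul_eq_div, le_div_iff₀ (by positivity), mul_comm]
  exact h3

/-- (Hardy–Littlewood) `H¹(𝔻)` embeds continuously into `A²(𝔻)`: there is `C > 0` with
`∫_𝔻 |f|² dA ≤ C ‖f‖_{H¹}²` for every holomorphic `f` on the unit disc. -/
theorem hardy_littlewood_H1_embeds_A2 :
    ∃ C : ℝ, 0 < C ∧ ∀ f : ℂ → ℂ, DifferentiableOn ℂ f (Metric.ball (0 : ℂ) 1) →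
      ∫⁻ z in Metric.ball (0 : ℂ) 1, ENNReal.ofReal (‖f z‖ ^ 2)
        ≤ ENNReal.ofReal C *
          (⨆ r : Ioo (0 : ℝ) 1, ENNReal.ofReal ((2 * Real.pi)⁻¹ *
            ∫ θ in (0 : ℝ)..(2 * Real.pi),
              ‖f (((r : ℝ) : ℂ) * Complex.exp ((θ : ℂ) * Complex.I))‖)) ^ 2 := by
  refine ⟨Real.pi ^ 2, by positivity, fun f hf => ?_⟩
  obtain ⟨a, ha⟩ : ∃ a : ℕ → ℂ, ∀ z ∈ Metric.ball (0:ℂ) 1, HasSum (fun n => a n * z^n) (f z) := by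
    refine ⟨fun n => ((n.factorial : ℂ))⁻¹ * iteratedDeriv n f 0, fun z hz => ?_⟩
    have h := Complex.hasSum_taylorSeries_on_ball hf hz
    simp only [sub_zero, smul_eq_mul] at h
    have e : (fun n : ℕ => ((n.factorial : ℂ))⁻¹ * iteratedDeriv n f 0 * z^n)
        = fun n : ℕ => ((n.factorial : ℂ))⁻¹ * (z^n * iteratedDeriv n f 0) := by
      ext n; ring
    rw [e]; exact h
  have hmem : ∀ r : ℝ, 0 < r → r < 1 → ∀ θ : ℝ,
      (r:ℂ) * Complex.exp (θ * Complex.I) ∈ Metric.ball (0:ℂ) 1 := by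
    intro r h0 h1 θ
    rw [mem_ball_zero_iff, norm_mul, Complex.norm_exp_ofReal_mul_I, mul_one, Complex.norm_real,
      Real.norm_of_nonneg h0.le]
    exact h1
  have hsum : ∀ r : ℝ, 0 < r → r < 1 → Summable fun n => ‖a n * (r:ℂ)^n‖ := by
    intro r h0 h1
    have := (ha _ (hmem r h0 h1 0)).summable.norm
    simpa using this
  have hfs : ∀ r : ℝ, 0 < r → r < 1 → ∀ θ : ℝ, f ((r:ℂ) * Complex.exp (θ * Complex.I))
      = ∑' n : ℕ, (a n * (r:ℂ)^n) * Complex.exp ((n:ℂ) * θ * Complex.I) := by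
    intro r h0 h1 θ
    rw [← (ha _ (hmem r h0 h1 θ)).tsum_eq]
    congr 1; ext n
    rw [mul_pow, ← Complex.exp_nat_mul]; ring_nf
  have hnorm : ∀ r : ℝ, 0 < r → ∀ n : ℕ, ‖a n * (r:ℂ)^n‖^2 = ‖a n‖^2 * r^(2*n) := by
    intro r h0 n
    rw [norm_mul, norm_pow, Complex.norm_real, Real.norm_of_nonneg h0.le]; ring
  set S := ⨆ r : Ioo (0 : ℝ) 1, ENNReal.ofReal ((2 * Real.pi)⁻¹ *
            ∫ θ in (0 : ℝ)..(2 * Real.pi),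
              ‖f (((r : ℝ) : ℂ) * Complex.exp ((θ : ℂ) * Complex.I))‖) with hS
  -- bound on the coefficients
  have hcoef : ∀ N : ℕ, ENNReal.ofReal (∑ n ∈ Finset.range N, ‖a n‖^2 / (n+1))
      ≤ ENNReal.ofReal Real.pi * S^2 := by
    intro N
    have hr : ∀ r : ℝ, 0 < r → r < 1 →
        ENNReal.ofReal (∑ n ∈ Finset.range N, ‖a n‖^2 * r^(2*n) / (n+1))
          ≤ ENNReal.ofReal Real.pi * S^2 := by
      intro r h0 h1
      have h := HL_main _ (hsum r h0 h1) N
      simp only [← hfs r h0 h1, hnorm r h0] at h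
      refine (ENNReal.ofReal_le_ofReal h).trans ?_
      rw [ENNReal.ofReal_mul Real.pi_pos.le, ENNReal.ofReal_pow]
      · gcongr
        exact le_iSup (fun r : Ioo (0 : ℝ) 1 => ENNReal.ofReal ((2 * Real.pi)⁻¹ *
            ∫ θ in (0 : ℝ)..(2 * Real.pi),
              ‖f (((r : ℝ) : ℂ) * Complex.exp ((θ : ℂ) * Complex.I))‖)) ⟨r, h0, h1⟩
      · exact mul_nonneg (by positivity)
          (intervalIntegral.integral_nonneg (by positivity) (fun _ _ => norm_nonneg _))
    have hc : Continuous fun r : ℝ =>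
        ENNReal.ofReal (∑ n ∈ Finset.range N, ‖a n‖^2 * r^(2*n) / (n+1)) :=
      ENNReal.continuous_ofReal.comp (by fun_prop)
    have ht := (hc.tendsto 1).mono_left (nhdsWithin_le_nhds (s := Iio 1))
    simp only [one_pow, mul_one] at ht
    refine le_of_tendsto ht ?_
    filter_upwards [Ioo_mem_nhdsLT (zero_lt_one (α := ℝ))] with r hrm using hr r hrm.1 hrm.2
  -- polar coordinates
  set g : ℂ → ENNReal := (Metric.ball (0:ℂ) 1).indicator (fun z => ENNReal.ofReal (‖f z‖^2)) with hg
  have hgm : Measurable g := by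
    have h1 : Measurable ((Metric.ball (0:ℂ) 1).indicator f) := by
      classical
      have := hf.continuousOn.measurable_piecewise (g := (0 : ℂ → ℂ)) continuousOn_const
        Metric.isOpen_ball.measurableSet
      rwa [Set.piecewise_eq_indicator] at this
    have h2 : g = fun z => ENNReal.ofReal (‖(Metric.ball (0:ℂ) 1).indicator f z‖^2) := by
      ext z
      by_cases hz : z ∈ Metric.ball (0:ℂ) 1
      · simp only [hg, indicator_of_mem hz]
      · simp only [hg, indicator_of_notMem hz]; simp
    rw [h2]
    exact (h1.norm.pow_const 2).ennreal_ofReal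
  have hinner : ∀ ρ ∈ Ioi (0:ℝ), ∫⁻ θ in Ioo (-Real.pi) Real.pi,
      ENNReal.ofReal ρ * g ((ρ:ℂ) * (Real.cos θ + Real.sin θ * Complex.I))
      ≤ ∑' n : ℕ, (Ioo (0:ℝ) 1).indicator
          (fun ρ => ENNReal.ofReal (2 * Real.pi * ‖a n‖^2 * ρ^(2*n+1))) ρ := by
    intro ρ h0
    rw [mem_Ioi] at h0
    have he : ∀ θ : ℝ, (Real.cos θ + Real.sin θ * Complex.I : ℂ) = Complex.exp (θ * Complex.I) := by
      intro θ; rw [Complex.exp_mul_I, Complex.ofReal_cos, Complex.ofReal_sin]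
    simp only [he]
    by_cases h1 : ρ < 1
    · simp only [indicator_of_mem (show ρ ∈ Ioo (0:ℝ) 1 from ⟨h0, h1⟩), hg,
        indicator_of_mem (hmem ρ h0 h1 _), hfs ρ h0 h1]
      rw [lintegral_const_mul' _ _ ENNReal.ofReal_ne_top]
      have hP := HL_pars2 _ (hsum ρ h0 h1)
      have hc := HL_cont _ (hsum ρ h0 h1)
      have hp := HL_per (fun n => a n * (ρ:ℂ)^n)
      set F := fun t : ℝ => ∑' n : ℕ, (a n * (ρ:ℂ)^n) * Complex.exp ((n:ℂ) * t * Complex.I) with hF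
      have hp2 : Function.Periodic (fun t => ‖F t‖^2) (2*Real.pi) := hp.comp (fun z => ‖z‖^2)
      have hi := hp2.intervalIntegral_add_eq (-Real.pi) 0
      have e1 : -Real.pi + 2 * Real.pi = Real.pi := by ring
      rw [e1, zero_add] at hi
      have hle : -Real.pi ≤ Real.pi := by linarith [Real.pi_pos]
      have hl : ∫⁻ θ in Ioo (-Real.pi) Real.pi, ENNReal.ofReal (‖F θ‖^2)
          = ENNReal.ofReal (∫ t in (0:ℝ)..(2*Real.pi), ‖F t‖^2) := by
        rw [← hi, intervalIntegral.integral_of_le hle, integral_Ioc_eq_integral_Ioo,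
          ofReal_integral_eq_lintegral_ofReal]
        · have : Continuous fun t => ‖F t‖^2 := by fun_prop
          exact (this.integrableOn_Icc).mono_set Ioo_subset_Icc_self
        · filter_upwards with t using by positivity
      change ENNReal.ofReal ρ * ∫⁻ θ in Ioo (-Real.pi) Real.pi, ENNReal.ofReal (‖F θ‖^2) ≤ _
      rw [hl, ← hP.tsum_eq, ENNReal.ofReal_tsum_of_nonneg (fun n => by positivity) hP.summable,
        ← ENNReal.tsum_mul_left]
      refine le_of_eq (tsum_congr fun n => ?_)
      rw [← ENNReal.ofReal_mul h0.le, hnorm ρ h0]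
      congr 1; ring
    · have hz : ∀ θ : ℝ, g ((ρ:ℂ) * Complex.exp (θ * Complex.I)) = 0 := by
        intro θ
        apply indicator_of_notMem
        rw [mem_ball_zero_iff, norm_mul, Complex.norm_exp_ofReal_mul_I, mul_one, Complex.norm_real,
          Real.norm_of_nonneg h0.le]
        exact h1
      simp [hz]
  have hone : ∀ n : ℕ, ∫⁻ ρ in Ioi (0:ℝ), (Ioo (0:ℝ) 1).indicator
          (fun ρ => ENNReal.ofReal (2 * Real.pi * ‖a n‖^2 * ρ^(2*n+1))) ρ
        ≤ ENNReal.ofReal Real.pi * ENNReal.ofReal (‖a n‖^2/(n+1)) := by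
    intro n
    refine (setLIntegral_le_lintegral _ _).trans ?_
    rw [lintegral_indicator measurableSet_Ioo, ← ofReal_integral_eq_lintegral_ofReal,
      ← integral_Ioc_eq_integral_Ioo, ← intervalIntegral.integral_of_le zero_le_one,
      intervalIntegral.integral_const_mul, integral_pow, ← ENNReal.ofReal_mul Real.pi_pos.le]
    · apply le_of_eq
      congr 1
      push_cast
      have : (n:ℝ)+1 ≠ 0 := by positivity
      have h2 : 2*(n:ℝ)+1+1 = 2*((n:ℝ)+1) := by ring
      rw [h2, one_pow, zero_pow (by omega)]
      field_simp
      try ring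
    · have : Continuous fun ρ : ℝ => 2 * Real.pi * ‖a n‖^2 * ρ^(2*n+1) := by fun_prop
      exact (this.integrableOn_Icc).mono_set Ioo_subset_Icc_self
    · filter_upwards [ae_restrict_mem measurableSet_Ioo] with ρ hρ
      have := hρ.1
      simp only [Pi.zero_apply]
      positivity
  calc ∫⁻ z in Metric.ball (0 : ℂ) 1, ENNReal.ofReal (‖f z‖ ^ 2)
      = ∫⁻ z, g z := (lintegral_indicator measurableSet_ball _).symm
    _ = ∫⁻ p in Ioi (0:ℝ) ×ˢ Ioo (-Real.pi) Real.pi, ENNReal.ofReal p.1 *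
          g ((p.1:ℂ) * (Real.cos p.2 + Real.sin p.2 * Complex.I)) := by
        rw [← Complex.lintegral_comp_polarCoord_symm g]
        simp only [Complex.polarCoord_symm_apply, smul_eq_mul, polarCoord_target]
    _ = ∫⁻ ρ in Ioi (0:ℝ), ∫⁻ θ in Ioo (-Real.pi) Real.pi, ENNReal.ofReal ρ *
          g ((ρ:ℂ) * (Real.cos θ + Real.sin θ * Complex.I)) := by
        rw [Measure.volume_eq_prod, setLIntegral_prod]
        apply Measurable.aemeasurable
        exact (measurable_fst.ennreal_ofReal).mul (hgm.comp (by fun_prop))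
    _ ≤ ∫⁻ ρ in Ioi (0:ℝ), ∑' n : ℕ, (Ioo (0:ℝ) 1).indicator
          (fun ρ => ENNReal.ofReal (2 * Real.pi * ‖a n‖^2 * ρ^(2*n+1))) ρ :=
        setLIntegral_mono' measurableSet_Ioi hinner
    _ = ∑' n : ℕ, ∫⁻ ρ in Ioi (0:ℝ), (Ioo (0:ℝ) 1).indicator
          (fun ρ => ENNReal.ofReal (2 * Real.pi * ‖a n‖^2 * ρ^(2*n+1))) ρ := by
        apply lintegral_tsum
        intro n
        apply Measurable.aemeasurable
        apply Measurable.indicator _ measurableSet_Ioo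
        fun_prop
    _ ≤ ∑' n : ℕ, ENNReal.ofReal Real.pi * ENNReal.ofReal (‖a n‖^2/(n+1)) :=
        ENNReal.tsum_le_tsum hone
    _ ≤ ENNReal.ofReal Real.pi * (ENNReal.ofReal Real.pi * S^2) := by
        rw [ENNReal.tsum_mul_left]
        gcongr
        rw [ENNReal.tsum_eq_iSup_nat]
        refine iSup_le fun N => ?_
        rw [← ENNReal.ofReal_sum_of_nonneg (fun n _ => by positivity)]
        exact hcoef N
    _ = ENNReal.ofReal (Real.pi^2) * S^2 := by
        rw [← mul_assoc, ← ENNReal.ofReal_mul Real.pi_pos.le, sq Real.pi]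

end
end

section
/- (Calderón–Zygmund) Let S ⊆ ℝ be a measurable set of finite Lebesgue measure. Then there exist constants A_S, B_S ≥ 0, depending only on S, such that for every λ > 0 and every measurable g : ℝ → ℂ with ∫_ℝ |g(t)| (1 + log⁺|g(t)|) dt < ∞, the truncated Hilbert-type transform g̃_λ(x) = ∫_{|x − y| > 1/λ} g(y)/(x − y) dy satisfies ∫_S |g̃_λ(x)| dx ≤ A_S ∫_ℝ |g(t)| (1 + log⁺|g(t)|) dt + B_S. -/
open MeasureTheory Set

noncomputable section

/-- The truncated Hilbert-type transform `g̃_λ(x) = ∫_{|x−y| > 1/λ} g(y)/(x − y) dy`. -/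
def truncatedHilbert (lam : ℝ) (g : ℝ → ℂ) (x : ℝ) : ℂ :=
  ∫ y in {y : ℝ | 1 / lam < |x - y|}, g y / (((x - y : ℝ)) : ℂ)


/-- The Poisson-type kernel. -/
def czP (ε u : ℝ) : ℝ := ε / (u ^ 2 + ε ^ 2)

/-- Cauchy integral of a real density. -/
def czF (ψ : ℝ → ℝ) (z : ℂ) : ℂ := ∫ t : ℝ, (ψ t : ℂ) / (z - t)

theorem czP_eq {ε : ℝ} (hε : 0 < ε) (u : ℝ) : czP ε u = ε⁻¹ * (1 + (u / ε) ^ 2)⁻¹ := by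
  unfold czP
  have : u ^ 2 + ε ^ 2 ≠ 0 := by positivity
  have : 1 + (u / ε) ^ 2 ≠ 0 := by positivity
  field_simp
  ring

theorem czP_nonneg {ε : ℝ} (hε : 0 < ε) (u : ℝ) : 0 ≤ czP ε u := by
  unfold czP; positivity

theorem czP_integrable {ε : ℝ} (hε : 0 < ε) : Integrable (czP ε) := by
  have h := (integrable_inv_one_add_sq.comp_div hε.ne').const_mul ε⁻¹
  exact h.congr (Filter.Eventually.of_forall fun u => (czP_eq hε u).symm)

theorem czP_integral {ε : ℝ} (hε : 0 < ε) : ∫ u, czP ε u = Real.pi := by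
  simp_rw [czP_eq hε]
  rw [integral_const_mul, Measure.integral_comp_div (fun x : ℝ => (1 + x ^ 2)⁻¹) ε,
    integral_univ_inv_one_add_sq, abs_of_pos hε, smul_eq_mul]
  field_simp

theorem czP_neg (ε u : ℝ) : czP ε (-u) = czP ε u := by simp [czP]

theorem czF_kernel_ne {z : ℂ} (hz : 0 < z.im) (t : ℝ) : z - (t : ℂ) ≠ 0 := by
  intro h
  have := congrArg Complex.im h
  simp at this
  exact hz.ne' this

theorem czF_kernel_norm {z : ℂ} (t : ℝ) : |z.im| ≤ ‖z - (t : ℂ)‖ := by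
  have := Complex.abs_im_le_norm (z - (t : ℂ))
  simpa using this

theorem czF_meas {ψ : ℝ → ℝ} (hm : Measurable ψ) (z : ℂ) :
    Measurable (fun t : ℝ => (ψ t : ℂ) / (z - t)) := by
  fun_prop

theorem czF_integrable {ψ : ℝ → ℝ} (hm : Measurable ψ) (hi : Integrable ψ) {z : ℂ}
    (hz : 0 < z.im) : Integrable (fun t : ℝ => (ψ t : ℂ) / (z - t)) := by
  refine Integrable.mono' (hi.norm.mul_const z.im⁻¹) (czF_meas hm z).aestronglyMeasurable
    (Filter.Eventually.of_forall fun t => ?_)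
  have := czF_kernel_norm (z := z) t
  rw [abs_of_pos hz] at this
  rw [norm_div, Complex.norm_real, div_eq_mul_inv]
  gcongr

theorem czF_hasDeriv {ψ : ℝ → ℝ} (hm : Measurable ψ) (hi : Integrable ψ) {z : ℂ}
    (hz : 0 < z.im) : DifferentiableAt ℂ (czF ψ) z := by
  have hpos : ∀ w ∈ Metric.ball z (z.im / 2), z.im / 2 < w.im := by
    intro w hw
    have h1 := Complex.abs_im_le_norm (w - z)
    rw [Metric.mem_ball, dist_eq_norm] at hw
    have h2 := (abs_lt.1 (h1.trans_lt hw)).1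
    simp at h2
    linarith
  have key := hasDerivAt_integral_of_dominated_loc_of_deriv_le (μ := volume)
    (F := fun (w : ℂ) (t : ℝ) => (ψ t : ℂ) / (w - t))
    (F' := fun (w : ℂ) (t : ℝ) => -(ψ t : ℂ) / (w - t) ^ 2) (x₀ := z)
    (s := Metric.ball z (z.im / 2)) (bound := fun t => ‖ψ t‖ * ((z.im / 2) ^ 2)⁻¹)
    (Metric.ball_mem_nhds z (by positivity))
    (Filter.Eventually.of_forall fun w => (czF_meas hm w).aestronglyMeasurable)
    (czF_integrable hm hi hz)
    (by apply Measurable.aestronglyMeasurable; fun_prop)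
    (Filter.Eventually.of_forall fun t w hw => by
      have h1 := hpos w hw
      have h2 := czF_kernel_norm (z := w) t
      rw [abs_of_pos (by linarith)] at h2
      rw [norm_div, norm_neg, Complex.norm_real, norm_pow, div_eq_mul_inv]
      gcongr
      linarith)
    (hi.norm.mul_const _)
    (Filter.Eventually.of_forall fun t w hw => by
      have h1 := hpos w hw
      have h3 := czF_kernel_ne (z := w) (by linarith) t
      have h4 := ((hasDerivAt_id w).sub_const (t : ℂ)).inv h3
      have h5 := h4.const_mul (ψ t : ℂ)
      exact h5.congr_deriv (by simp only [id]; ring))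
  exact key.2.differentiableAt

theorem czF_decay {ψ : ℝ → ℝ} {M : ℝ} (hM : 0 < M)
    (hb : ∀ t, |ψ t| ≤ (Icc (-M) M).indicator (fun _ => (1 : ℝ)) t) {z : ℂ}
    (hz : 2 * M ≤ ‖z‖) : ‖czF ψ z‖ ≤ 4 * M / ‖z‖ := by
  have hzp : 0 < ‖z‖ := by linarith
  have h1 : ‖czF ψ z‖ ≤ ∫ t : ℝ, (Icc (-M) M).indicator (fun _ => 2 / ‖z‖) t := by
    refine norm_integral_le_of_norm_le ?_ (Filter.Eventually.of_forall fun t => ?_)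
    · rw [integrable_indicator_iff measurableSet_Icc]
      exact integrableOn_const (by simp)
    · have h := hb t
      by_cases ht : t ∈ Icc (-M) M
      · rw [indicator_of_mem ht] at h ⊢
        rw [norm_div, Complex.norm_real]
        have h2 : ‖z‖ / 2 ≤ ‖z - (t : ℂ)‖ := by
          have h3 := norm_sub_norm_le z (t : ℂ)
          rw [Complex.norm_real] at h3
          have : ‖t‖ ≤ M := abs_le.2 ht
          linarith
        calc ‖ψ t‖ / ‖z - (t : ℂ)‖ ≤ 1 / (‖z‖ / 2) := by
              gcongr
              exact h
          _ = _ := by field_simp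
      · rw [indicator_of_notMem ht] at h ⊢
        have : ψ t = 0 := by simpa using h
        simp [this]
  refine h1.trans_eq ?_
  rw [integral_indicator measurableSet_Icc, setIntegral_const]
  simp [hM.le]
  field_simp
  norm_num

theorem czF_im {ψ : ℝ → ℝ} (hm : Measurable ψ) (hi : Integrable ψ) {ε : ℝ} (hε : 0 < ε) (y : ℝ) :
    (czF ψ (y + ε * Complex.I)).im = - ∫ t, ψ t * czP ε (y - t) := by
  have hz : 0 < ((y : ℂ) + ε * Complex.I).im := by simpa using hε
  have h := (RCLike.imCLM (K := ℂ)).integral_comp_comm (czF_integrable hm hi hz)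
  have h' : (czF ψ (y + ε * Complex.I)).im
      = ∫ t : ℝ, ((ψ t : ℂ) / ((y : ℂ) + ε * Complex.I - t)).im := h.symm
  rw [h', ← integral_neg]
  congr 1
  funext t
  rw [Complex.div_im]
  simp [Complex.normSq_apply, czP]
  ring

theorem czF_re {ψ : ℝ → ℝ} (hm : Measurable ψ) (hi : Integrable ψ) {ε : ℝ} (hε : 0 < ε) (y : ℝ) :
    (czF ψ (y + ε * Complex.I)).re = ∫ t, ψ t * ((y - t) / ((y - t) ^ 2 + ε ^ 2)) := by
  have hz : 0 < ((y : ℂ) + ε * Complex.I).im := by simpa using hε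
  have h := (RCLike.reCLM (K := ℂ)).integral_comp_comm (czF_integrable hm hi hz)
  have h' : (czF ψ (y + ε * Complex.I)).re
      = ∫ t : ℝ, ((ψ t : ℂ) / ((y : ℂ) + ε * Complex.I - t)).re := h.symm
  rw [h']
  congr 1
  funext t
  rw [Complex.div_re]
  simp [Complex.normSq_apply]
  ring

theorem cz_cosh_bound {w : ℂ} (hw : ‖w‖ ≤ 1) : ‖Complex.cosh w - 1‖ ≤ ‖w‖ ^ 2 := by
  have h1 := Complex.norm_exp_sub_one_sub_id_le hw
  have h2 := Complex.norm_exp_sub_one_sub_id_le (x := -w) (by simpa using hw)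
  rw [norm_neg] at h2
  have : Complex.cosh w - 1
      = ((Complex.exp w - 1 - w) + (Complex.exp (-w) - 1 - -w)) / 2 := by
    rw [Complex.cosh]; ring
  rw [this, norm_div]
  have h3 := norm_add_le (Complex.exp w - 1 - w) (Complex.exp (-w) - 1 - -w)
  simp only [Complex.norm_ofNat]
  linarith

theorem cz_cosh_re (w : ℂ) : (Complex.cosh w).re = Real.cosh w.re * Real.cos w.im := by
  conv_lhs => rw [← Complex.re_add_im w]
  rw [Complex.cosh_add, Complex.cosh_mul_I, Complex.sinh_mul_I]
  rw [← Complex.ofReal_cosh, ← Complex.ofReal_sinh, ← Complex.ofReal_cos, ← Complex.ofReal_sin]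
  simp [-Complex.ofReal_cos, -Complex.ofReal_sin, -Complex.ofReal_cosh, -Complex.ofReal_sinh]

theorem cz_rect {ψ : ℝ → ℝ} (hm : Measurable ψ) (hi : Integrable ψ) {M : ℝ} (hM : 0 < M)
    (hb : ∀ t, |ψ t| ≤ (Icc (-M) M).indicator (fun _ => (1 : ℝ)) t) {ε : ℝ} (hε : 0 < ε)
    {R : ℝ} (hR : 2 * M ≤ R) :
    ‖∫ x in (-R)..R, (Complex.cosh (czF ψ (x + ε * Complex.I) / 3) - 1)‖ ≤ 8 * M ^ 2 / R := by
  have hRp : 0 < R := by linarith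
  set G : ℂ → ℂ := fun z => Complex.cosh (czF ψ z / 3) - 1 with hG
  have hd : DifferentiableOn ℂ G
      (uIcc (-R) R ×ℂ uIcc ε (ε + R)) := by
    intro z hz
    apply DifferentiableAt.differentiableWithinAt
    have h2 := hz.2
    rw [mem_preimage, uIcc_of_le (by linarith)] at h2
    have hz0 : 0 < z.im := lt_of_lt_of_le hε h2.1
    have := czF_hasDeriv hm hi hz0
    simp only [hG]
    fun_prop
  have hGb : ∀ z : ℂ, R ≤ ‖z‖ → ‖G z‖ ≤ 2 * M ^ 2 / R ^ 2 := by
    intro z hz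
    have h1 := czF_decay hM hb (z := z) (hR.trans hz)
    have h2 : ‖czF ψ z / 3‖ ≤ 4 * M / R / 3 := by
      rw [norm_div]
      simp only [Complex.norm_ofNat]
      have : 4 * M / ‖z‖ ≤ 4 * M / R := by gcongr
      linarith
    have h3 : 4 * M / R ≤ 2 := by
      rw [div_le_iff₀ hRp]; linarith
    have h4 := cz_cosh_bound (w := czF ψ z / 3) (by linarith)
    refine h4.trans ?_
    calc ‖czF ψ z / 3‖ ^ 2 ≤ (4 * M / R / 3) ^ 2 := by gcongr
      _ = 16 / 9 * M ^ 2 / R ^ 2 := by ring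
      _ ≤ _ := by gcongr; norm_num
  have key := Complex.integral_boundary_rect_eq_zero_of_differentiableOn G
    ⟨-R, ε⟩ ⟨R, ε + R⟩ hd
  simp only at key
  have ht : ‖∫ x in (-R)..R, G (x + ((ε + R : ℝ) : ℂ) * Complex.I)‖
      ≤ 2 * M ^ 2 / R ^ 2 * |R - -R| := by
    apply intervalIntegral.norm_integral_le_of_norm_le_const
    intro x _
    apply hGb
    have := Complex.abs_im_le_norm ((x : ℂ) + ((ε + R : ℝ) : ℂ) * Complex.I)
    simp at this
    rw [abs_of_pos (by linarith)] at this
    push_cast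
    linarith
  have hr : ‖∫ y in ε..(ε + R), G ((R : ℝ) + (y : ℂ) * Complex.I)‖
      ≤ 2 * M ^ 2 / R ^ 2 * |ε + R - ε| := by
    apply intervalIntegral.norm_integral_le_of_norm_le_const
    intro y _
    apply hGb
    have := Complex.abs_re_le_norm (((R : ℝ) : ℂ) + (y : ℂ) * Complex.I)
    simp at this
    rw [abs_of_pos (by linarith)] at this
    linarith
  have hl : ‖∫ y in ε..(ε + R), G ((-R : ℝ) + (y : ℂ) * Complex.I)‖
      ≤ 2 * M ^ 2 / R ^ 2 * |ε + R - ε| := by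
    apply intervalIntegral.norm_integral_le_of_norm_le_const
    intro y _
    apply hGb
    have := Complex.abs_re_le_norm (((-R : ℝ) : ℂ) + (y : ℂ) * Complex.I)
    simp at this
    rw [abs_of_pos (by linarith)] at this
    push_cast
    linarith
  have e1 : |R - -R| = 2 * R := by rw [abs_of_pos] <;> linarith
  have e2 : |ε + R - ε| = R := by rw [abs_of_pos] <;> linarith
  rw [e1] at ht
  rw [e2] at hr hl
  generalize (∫ x in (-R)..R, G (x + ((ε + R : ℝ) : ℂ) * Complex.I)) = T at *
  generalize (∫ y in ε..(ε + R), G ((R : ℝ) + (y : ℂ) * Complex.I)) = Rr at *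
  generalize (∫ y in ε..(ε + R), G ((-R : ℝ) + (y : ℂ) * Complex.I)) = Ll at *
  have : (∫ x in (-R)..R, G (x + (ε : ℂ) * Complex.I))
      = T - Complex.I • Rr + Complex.I • Ll := by
    linear_combination key
  change ‖∫ x in (-R)..R, G (x + (ε : ℂ) * Complex.I)‖ ≤ _
  rw [this]
  have n1 := norm_add_le (T - Complex.I • Rr) (Complex.I • Ll)
  have n2 := norm_sub_le T (Complex.I • Rr)
  rw [norm_smul, Complex.norm_I, one_mul] at n1 n2
  have : 8 * M ^ 2 / R = 2 * M ^ 2 / R ^ 2 * (2 * R) + 2 * M ^ 2 / R ^ 2 * R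
      + 2 * M ^ 2 / R ^ 2 * R := by field_simp; ring
  linarith

theorem cz_conv_eq (ψ : ℝ → ℝ) (ε y : ℝ) :
    (∫ t, |ψ t| * czP ε (y - t))
      = convolution (fun t => |ψ t|) (czP ε) (ContinuousLinearMap.mul ℝ ℝ) volume y := by
  rw [convolution_def]
  rfl

theorem cz_conv_le {ψ : ℝ → ℝ} (hm : Measurable ψ) (hb1 : ∀ t, |ψ t| ≤ 1) {ε : ℝ} (hε : 0 < ε)
    (y : ℝ) : Integrable (fun t => |ψ t| * czP ε (y - t)) ∧
      ∫ t, |ψ t| * czP ε (y - t) ≤ Real.pi := by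
  have h1 := (czP_integrable hε).comp_sub_left y
  have h2 : Integrable (fun t => |ψ t| * czP ε (y - t)) := by
    refine h1.mono' (AEStronglyMeasurable.mul ?_ h1.aestronglyMeasurable)
      (Filter.Eventually.of_forall fun t => ?_)
    · exact hm.abs.aestronglyMeasurable
    · rw [norm_mul, Real.norm_eq_abs, abs_abs, Real.norm_of_nonneg (czP_nonneg hε _)]
      exact mul_le_of_le_one_left (czP_nonneg hε _) (hb1 t)
  refine ⟨h2, ?_⟩
  calc ∫ t, |ψ t| * czP ε (y - t) ≤ ∫ t, czP ε (y - t) :=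
        integral_mono h2 h1 fun t => mul_le_of_le_one_left (czP_nonneg hε _) (hb1 t)
    _ = ∫ t, czP ε t := integral_sub_left_eq_self (czP ε) volume y
    _ = Real.pi := czP_integral hε

theorem cz_exp {ψ : ℝ → ℝ} (hm : Measurable ψ) (hi : Integrable ψ) {M : ℝ} (hM : 0 < M)
    (hb : ∀ t, |ψ t| ≤ (Icc (-M) M).indicator (fun _ => (1 : ℝ)) t) {ε : ℝ} (hε : 0 < ε) :
    ∫⁻ y : ℝ, ENNReal.ofReal (Real.cosh ((czF ψ (y + ε * Complex.I)).re / 3) - 1)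
      ≤ ENNReal.ofReal (2 * ∫ t, |ψ t|) := by
  have hb1 : ∀ t, |ψ t| ≤ 1 := fun t => (hb t).trans
    (indicator_le_self' (fun _ _ => zero_le_one) t)
  have hFc : Continuous (fun y : ℝ => czF ψ (y + ε * Complex.I)) := by
    rw [continuous_iff_continuousAt]
    intro y
    have hz : 0 < ((y : ℂ) + ε * Complex.I).im := by simpa using hε
    have h1 : ContinuousAt (czF ψ) ((fun y : ℝ => (y : ℂ) + ε * Complex.I) y) :=
      (czF_hasDeriv hm hi hz).continuousAt
    exact ContinuousAt.comp (f := fun y : ℝ => (y : ℂ) + ε * Complex.I) h1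
      (by fun_prop)
  set F : ℝ → ℂ := fun y => czF ψ (y + ε * Complex.I) with hF
  set C : ℝ → ℝ := fun y => ∫ t, |ψ t| * czP ε (y - t) with hC
  have hCi : Integrable C := by
    have := Integrable.integrable_convolution (ContinuousLinearMap.mul ℝ ℝ) hi.abs
      (czP_integrable hε)
    refine this.congr (Filter.Eventually.of_forall fun y => ?_)
    exact (cz_conv_eq ψ ε y).symm
  have hCint : ∫ y, C y = (∫ t, |ψ t|) * Real.pi := by
    have := integral_convolution (ContinuousLinearMap.mul ℝ ℝ) (μ := volume) (ν := volume) hi.abs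
      (czP_integrable hε)
    rw [czP_integral hε] at this
    rw [hC]
    simp_rw [cz_conv_eq]
    exact this
  have hC0 : ∀ y, 0 ≤ C y := fun y =>
    integral_nonneg fun t => mul_nonneg (abs_nonneg _) (czP_nonneg hε _)
  have hIm : ∀ y, |(F y).im| ≤ C y := by
    intro y
    simp only [hF]
    rw [czF_im hm hi hε, abs_neg]
    refine (abs_integral_le_integral_abs).trans_eq ?_
    simp only [hC, abs_mul, abs_of_nonneg (czP_nonneg hε _)]
  have hCpi : ∀ y, C y ≤ Real.pi := fun y => (cz_conv_le hm hb1 hε y).2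
  have hpt : ∀ y, Real.cosh ((F y).re / 3) - 1
      ≤ 2 * (Complex.cosh (F y / 3) - 1).re + Real.pi / 9 * C y := by
    intro y
    have e1 : (Complex.cosh (F y / 3) - 1).re
        = Real.cosh ((F y).re / 3) * Real.cos ((F y).im / 3) - 1 := by
      rw [Complex.sub_re, cz_cosh_re]
      simp
    rw [e1]
    set b := (F y).im / 3 with hbdef
    have hbabs : |b| ≤ C y / 3 := by
      rw [hbdef, abs_div, abs_of_pos (by norm_num : (0 : ℝ) < 3)]
      linarith [hIm y]
    have hbpi : |b| ≤ Real.pi / 3 := hbabs.trans (by linarith [hCpi y])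
    have hcos : 1 / 2 ≤ Real.cos b := by
      rw [← Real.cos_pi_div_three, ← Real.cos_abs b]
      exact Real.cos_le_cos_of_nonneg_of_le_pi (abs_nonneg _) (by linarith [Real.pi_pos]) hbpi
    have hcos2 := Real.one_sub_sq_div_two_le_cos (x := b)
    have hb2 : b ^ 2 ≤ Real.pi / 3 * (C y / 3) := by
      rw [← sq_abs, sq]
      exact mul_le_mul hbpi hbabs (abs_nonneg _) (by positivity)
    have hch := Real.one_le_cosh ((F y).re / 3)
    nlinarith [mul_nonneg (sub_nonneg.2 hch) (sub_nonneg.2 hcos)]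
  have hI0 : 0 ≤ ∫ t, |ψ t| := integral_nonneg fun t => abs_nonneg _
  have hbound : ∀ R : ℝ, 2 * M ≤ R →
      ∫⁻ y in Ioc (-R) R, ENNReal.ofReal (Real.cosh ((F y).re / 3) - 1)
        ≤ ENNReal.ofReal (16 * M ^ 2 / R + 2 * ∫ t, |ψ t|) := by
    intro R hR
    have hRp : 0 < R := by linarith
    have hc1 : Continuous (fun y => Real.cosh ((F y).re / 3) - 1) := by
      have := Complex.continuous_re.comp hFc
      exact (Real.continuous_cosh.comp (this.div_const 3)).sub continuous_const
    have hc2 : Continuous (fun y => Complex.cosh (F y / 3) - 1) :=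
      (Complex.continuous_cosh.comp (hFc.div_const 3)).sub continuous_const
    have hc3 : Continuous (fun y => (Complex.cosh (F y / 3) - 1).re) :=
      Complex.continuous_re.comp hc2
    have hi1 : IntegrableOn (fun y => Real.cosh ((F y).re / 3) - 1) (Ioc (-R) R) :=
      hc1.integrableOn_Ioc
    rw [← ofReal_integral_eq_lintegral_ofReal hi1
      (Filter.Eventually.of_forall fun y => sub_nonneg.2 (Real.one_le_cosh _))]
    apply ENNReal.ofReal_le_ofReal
    have hi2 : IntegrableOn (fun y => 2 * (Complex.cosh (F y / 3) - 1).re) (Ioc (-R) R) :=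
      (hc3.integrableOn_Ioc).const_mul 2
    have hi3 : IntegrableOn (fun y => Real.pi / 9 * C y) (Ioc (-R) R) :=
      (hCi.const_mul _).integrableOn
    have s1 : ∫ y in Ioc (-R) R, (Real.cosh ((F y).re / 3) - 1)
        ≤ ∫ y in Ioc (-R) R, (2 * (Complex.cosh (F y / 3) - 1).re + Real.pi / 9 * C y) :=
      integral_mono hi1 (hi2.add hi3) hpt
    rw [integral_add hi2 hi3, integral_const_mul, integral_const_mul] at s1
    have s2 : ∫ y in Ioc (-R) R, C y ≤ (∫ t, |ψ t|) * Real.pi := by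
      rw [← hCint]
      exact setIntegral_le_integral hCi (Filter.Eventually.of_forall hC0)
    have s3 : ∫ y in Ioc (-R) R, (Complex.cosh (F y / 3) - 1).re ≤ 8 * M ^ 2 / R := by
      have h := (RCLike.reCLM (K := ℂ)).integral_comp_comm
        (μ := volume.restrict (Ioc (-R) R)) (hc2.integrableOn_Ioc)
      have h' : ∫ y in Ioc (-R) R, (Complex.cosh (F y / 3) - 1).re
        = (∫ y in Ioc (-R) R, (Complex.cosh (F y / 3) - 1)).re := h
      rw [h']
      refine (Complex.re_le_norm _).trans ?_
      have h2 := cz_rect hm hi hM hb hε hR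
      rwa [intervalIntegral.integral_of_le (by linarith)] at h2
    have s4 : Real.pi / 9 * ((∫ t, |ψ t|) * Real.pi) ≤ 2 * ∫ t, |ψ t| := by
      have : Real.pi * Real.pi ≤ 18 := by nlinarith [Real.pi_lt_d2, Real.pi_pos]
      nlinarith
    have s5 : Real.pi / 9 * ∫ y in Ioc (-R) R, C y ≤ Real.pi / 9 * ((∫ t, |ψ t|) * Real.pi) := by
      gcongr
    have : 16 * M ^ 2 / R = 2 * (8 * M ^ 2 / R) := by ring
    linarith
  have hlim1 := (aecover_Ioc (μ := volume) (Filter.tendsto_neg_atTop_atBot (G := ℝ))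
    (Filter.tendsto_id)).lintegral_tendsto_of_countably_generated
    (f := fun y => ENNReal.ofReal (Real.cosh ((F y).re / 3) - 1)) (by
      have := Complex.measurable_re.comp hFc.measurable
      have h2 := Real.measurable_cosh.comp (this.div_const 3)
      exact (h2.sub_const 1).ennreal_ofReal.aemeasurable)
  have hlim2 : Filter.Tendsto (fun R : ℝ => ENNReal.ofReal (16 * M ^ 2 / R + 2 * ∫ t, |ψ t|))
      Filter.atTop (nhds (ENNReal.ofReal (2 * ∫ t, |ψ t|))) := by
    apply ENNReal.tendsto_ofReal
    have h := (Filter.Tendsto.const_div_atTop (r := 16 * M ^ 2)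
      (Filter.tendsto_id (α := ℝ) (x := Filter.atTop))).add_const (2 * ∫ t, |ψ t|)
    simpa using h
  refine le_of_tendsto_of_tendsto hlim1 hlim2 ?_
  filter_upwards [Filter.eventually_ge_atTop (2 * M)] with R hR
  exact hbound R hR

theorem cz_logPlus_nonneg (a : ℝ) : 0 ≤ logPlus a := Real.log_nonneg (le_max_right _ _)

theorem cz_logPlus_mono {a b : ℝ} (h : a ≤ b) : logPlus a ≤ logPlus b := by
  unfold logPlus
  exact Real.log_le_log (lt_of_lt_of_le one_pos (le_max_right _ _)) (max_le_max_right 1 h)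

theorem cz_young {a u : ℝ} (ha : 0 ≤ a) (hu : 0 ≤ u) :
    a * u ≤ 2 * (a * (1 + logPlus a)) + 4 * (Real.cosh u - 1) := by
  have hL := cz_logPlus_nonneg a
  have hch := Real.one_le_cosh u
  rcases le_total u 2 with h | h
  · nlinarith [mul_nonneg ha hL]
  · have h1 : a * u ≤ a * logPlus a + Real.exp u := by
      rcases le_total a 1 with h1 | h1
      · have := Real.add_one_le_exp u
        nlinarith [mul_nonneg ha hL]
      · have hl : logPlus a = Real.log a := by rw [logPlus, max_eq_left h1]
        have h2 := Real.add_one_le_exp (u - Real.log a)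
        rw [Real.exp_sub, Real.exp_log (by linarith)] at h2
        have h3 : a * (u - Real.log a + 1) ≤ a * (Real.exp u / a) := by gcongr
        rw [mul_div_cancel₀ _ (by linarith : a ≠ 0)] at h3
        rw [hl]
        nlinarith
    have h2 : Real.exp u ≤ 4 * (Real.cosh u - 1) := by
      rw [Real.cosh_eq]
      have e1 : 4 ≤ Real.exp u := by
        have := Real.add_one_le_exp (1 : ℝ)
        have h4 : Real.exp 2 = Real.exp 1 * Real.exp 1 := by rw [← Real.exp_add]; norm_num
        have h5 : Real.exp 2 ≤ Real.exp u := Real.exp_le_exp.2 h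
        nlinarith
      linarith [Real.exp_pos (-u)]
    nlinarith [mul_nonneg ha hL]

/-- The truncated Hilbert kernel. -/
def czK (ε u : ℝ) : ℝ := if ε < |u| then 1 / u else 0

theorem czK_measurable (ε : ℝ) : Measurable (czK ε) := by
  unfold czK
  refine Measurable.ite (measurableSet_lt measurable_const (by fun_prop)) ?_ measurable_const
  exact measurable_id.const_div 1

theorem czK_bound {ε : ℝ} (hε : 0 < ε) (u : ℝ) : |czK ε u| ≤ ε⁻¹ := by
  unfold czK
  split_ifs with h
  · rw [abs_div, abs_one, one_div]
    gcongr
  · simpa using hε.le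

theorem czQ_bound {ε : ℝ} (hε : 0 < ε) (u : ℝ) : |u / (u ^ 2 + ε ^ 2)| ≤ ε⁻¹ := by
  have hp : 0 < u ^ 2 + ε ^ 2 := by positivity
  rw [abs_div, abs_of_pos hp, div_le_iff₀ hp, ← div_eq_inv_mul, le_div_iff₀ hε, ← sq_abs u]
  nlinarith [sq_nonneg (|u| - ε), abs_nonneg u]

theorem czK_sub_czQ {ε : ℝ} (hε : 0 < ε) (u : ℝ) :
    |czK ε u - u / (u ^ 2 + ε ^ 2)| ≤ czP ε u := by
  have hp : 0 < u ^ 2 + ε ^ 2 := by positivity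
  unfold czK czP
  split_ifs with h
  · have hu : u ≠ 0 := by
      intro h0
      rw [h0, abs_zero] at h
      linarith
    have e : 1 / u - u / (u ^ 2 + ε ^ 2) = ε ^ 2 / (u * (u ^ 2 + ε ^ 2)) := by
      field_simp
      ring
    have hua : 0 < |u| := abs_pos.2 hu
    rw [e, abs_div, abs_mul, abs_of_pos hp, abs_of_pos (by positivity : 0 < ε ^ 2),
      div_le_div_iff₀ (by positivity) hp]
    have : ε ^ 2 ≤ ε * |u| := by nlinarith
    nlinarith [mul_le_mul_of_nonneg_right this hp.le]
  · rw [zero_sub, abs_neg, abs_div, abs_of_pos hp]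
    gcongr
    exact not_lt.1 h

theorem cz_dual_bound {ψ : ℝ → ℝ} (hm : Measurable ψ) (hi : Integrable ψ)
    (hb1 : ∀ t, |ψ t| ≤ 1) {ε : ℝ} (hε : 0 < ε) (y : ℝ) :
    |∫ x, ψ x * czK ε (x - y)| ≤ |(czF ψ (y + ε * Complex.I)).re| + Real.pi := by
  rw [czF_re hm hi hε]
  have hi1 : Integrable (fun x => ψ x * czK ε (x - y)) := by
    refine Integrable.mono' (hi.abs.mul_const ε⁻¹)
      (hm.mul ((czK_measurable ε).comp (measurable_id.sub_const y))).aestronglyMeasurable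
      (Filter.Eventually.of_forall fun x => ?_)
    rw [Real.norm_eq_abs, abs_mul]
    gcongr
    exact czK_bound hε _
  have hi2 : Integrable (fun t => ψ t * ((y - t) / ((y - t) ^ 2 + ε ^ 2))) := by
    refine Integrable.mono' (hi.abs.mul_const ε⁻¹)
      (Measurable.aestronglyMeasurable (by fun_prop))
      (Filter.Eventually.of_forall fun x => ?_)
    rw [Real.norm_eq_abs, abs_mul]
    gcongr
    exact czQ_bound hε _
  have h3 : |(∫ x, ψ x * czK ε (x - y)) + ∫ t, ψ t * ((y - t) / ((y - t) ^ 2 + ε ^ 2))|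
      ≤ Real.pi := by
    rw [← integral_add hi1 hi2]
    have hc := cz_conv_le hm hb1 hε y
    refine le_trans ?_ hc.2
    rw [← Real.norm_eq_abs]
    refine norm_integral_le_of_norm_le hc.1 (Filter.Eventually.of_forall fun x => ?_)
    rw [← mul_add, Real.norm_eq_abs, abs_mul]
    gcongr
    have h := czK_sub_czQ hε (x - y)
    rw [← czP_neg, neg_sub] at h
    have e : czK ε (x - y) + (y - x) / ((y - x) ^ 2 + ε ^ 2)
        = czK ε (x - y) - (x - y) / ((x - y) ^ 2 + ε ^ 2) := by
      have : (y - x) ^ 2 = (x - y) ^ 2 := by ring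
      rw [this]
      ring
    rw [e]
    exact h
  have h4 := abs_le.1 h3
  have h5 := abs_le.1 (le_refl |∫ t, ψ t * ((y - t) / ((y - t) ^ 2 + ε ^ 2))|)
  rw [abs_le]
  constructor <;> linarith

theorem cz_real {h : ℝ → ℝ} (hm : Measurable h) (hi : Integrable h) {S : Set ℝ}
    (hS : MeasurableSet S) {M : ℝ} (hM : 0 < M) (hSM : S ⊆ Icc (-M) M) {ε : ℝ} (hε : 0 < ε) :
    ∫⁻ x in S, ENNReal.ofReal |∫ y, czK ε (x - y) * h y|
      ≤ ENNReal.ofReal 10 * (∫⁻ t, ENNReal.ofReal (|h t| * (1 + logPlus |h t|)))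
        + ENNReal.ofReal 24 * volume S := by
  have hSfin : volume S < ⊤ := (measure_mono hSM).trans_lt (by simp)
  set T : ℝ → ℝ := fun x => ∫ y, czK ε (x - y) * h y with hT
  have hKm : Measurable (fun p : ℝ × ℝ => czK ε (p.1 - p.2)) :=
    (czK_measurable ε).comp (measurable_fst.sub measurable_snd)
  have hTm : Measurable T := by
    apply StronglyMeasurable.measurable
    apply StronglyMeasurable.integral_prod_right (f := fun x y => czK ε (x - y) * h y)
    exact (hKm.mul (hm.comp measurable_snd)).stronglyMeasurable
  set s : ℝ → ℝ := fun x => if 0 ≤ T x then 1 else -1 with hs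
  have hsm : Measurable s :=
    Measurable.ite (measurableSet_le measurable_const hTm) measurable_const measurable_const
  set ψ : ℝ → ℝ := S.indicator s with hψ
  have hψm : Measurable ψ := hsm.indicator hS
  have hsabs : ∀ x, |s x| = 1 := by
    intro x; simp only [hs]; split_ifs <;> simp
  have hψabs : ∀ x, |ψ x| = S.indicator (fun _ => (1 : ℝ)) x := by
    intro x
    by_cases hx : x ∈ S
    · simp [hψ, hx, hsabs]
    · simp [hψ, hx]
  have hb1 : ∀ t, |ψ t| ≤ 1 := fun t => by
    rw [hψabs]; exact indicator_le_self' (fun _ _ => zero_le_one) t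
  have hb : ∀ t, |ψ t| ≤ (Icc (-M) M).indicator (fun _ => (1 : ℝ)) t := fun t => by
    rw [hψabs]
    exact indicator_le_indicator_of_subset hSM (fun _ => zero_le_one) t
  have hone : Integrable (S.indicator (fun _ => (1 : ℝ))) := by
    rw [integrable_indicator_iff hS]
    exact integrableOn_const hSfin.ne
  have hψi : Integrable ψ := hone.mono' hψm.aestronglyMeasurable
    (Filter.Eventually.of_forall fun x => (hψabs x).le)
  have hψint : ∫ t, |ψ t| = (volume S).toReal := by
    simp_rw [hψabs]
    rw [integral_indicator hS, setIntegral_const]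
    simp [Measure.real]
  have hprod : Integrable (Function.uncurry fun x y => ψ x * (czK ε (x - y) * h y))
      (volume.prod volume) := by
    refine Integrable.mono' ((hψi.abs.mul_const ε⁻¹).mul_prod hi.abs) ?_
      (Filter.Eventually.of_forall fun p => ?_)
    · exact ((hψm.comp measurable_fst).mul
        (hKm.mul (hm.comp measurable_snd))).aestronglyMeasurable
    · simp only [Function.uncurry]
      rw [Real.norm_eq_abs, abs_mul, abs_mul, ← mul_assoc]
      gcongr
      exact czK_bound hε _
  have hswap := integral_integral_swap hprod
  have hψT : ∀ x, ψ x * T x = S.indicator (fun x => |T x|) x := by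
    intro x
    by_cases hx : x ∈ S
    · simp only [hψ, hx, indicator_of_mem, hs]
      split_ifs with h0
      · rw [abs_of_nonneg h0, one_mul]
      · rw [abs_of_neg (not_le.1 h0)]; ring
    · simp [hψ, hx]
  have hl : ∀ x, ∫ y, ψ x * (czK ε (x - y) * h y) = S.indicator (fun x => |T x|) x := by
    intro x
    rw [integral_const_mul, ← hψT]
  have hr : ∀ y, ∫ x, ψ x * (czK ε (x - y) * h y) = (∫ x, ψ x * czK ε (x - y)) * h y := by
    intro y
    rw [← integral_mul_const]
    simp only [mul_assoc]
  simp_rw [hl, hr] at hswap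
  have hTint : Integrable (S.indicator (fun x => |T x|)) := by
    have h := hprod.integral_prod_left
    simp only [Function.uncurry] at h
    simpa only [hl] using h
  have start : ∫⁻ x in S, ENNReal.ofReal |T x|
      ≤ ∫⁻ y, ENNReal.ofReal (|∫ x, ψ x * czK ε (x - y)| * |h y|) := by
    rw [← lintegral_indicator hS]
    have e : (S.indicator fun x => ENNReal.ofReal |T x|)
        = fun x => ENNReal.ofReal (S.indicator (fun x => |T x|) x) := by
      funext x
      by_cases hx : x ∈ S <;> simp [hx]
    rw [e, ← ofReal_integral_eq_lintegral_ofReal hTint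
      (Filter.Eventually.of_forall fun x => indicator_nonneg (fun _ _ => abs_nonneg _) x), hswap]
    refine (ENNReal.ofReal_le_ofReal (le_abs_self _)).trans ?_
    rw [← Real.enorm_eq_ofReal_abs]
    refine (enorm_integral_le_lintegral_enorm _).trans_eq ?_
    congr 1
    funext y
    rw [Real.enorm_eq_ofReal_abs, abs_mul]
  refine start.trans ?_
  have hcz := cz_exp hψm hψi hM hb hε
  rw [hψint] at hcz
  have hpt : ∀ y, ENNReal.ofReal (|∫ x, ψ x * czK ε (x - y)| * |h y|)
      ≤ ENNReal.ofReal 10 * ENNReal.ofReal (|h y| * (1 + logPlus |h y|))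
        + ENNReal.ofReal 12 *
          ENNReal.ofReal (Real.cosh ((czF ψ (y + ε * Complex.I)).re / 3) - 1) := by
    intro y
    have hL := cz_logPlus_nonneg |h y|
    have hhL : 0 ≤ |h y| * (1 + logPlus |h y|) := by positivity
    have hcosh := sub_nonneg.2 (Real.one_le_cosh ((czF ψ (y + ε * Complex.I)).re / 3))
    rw [← ENNReal.ofReal_mul (by norm_num), ← ENNReal.ofReal_mul (by norm_num),
      ← ENNReal.ofReal_add (by positivity) (by positivity)]
    apply ENNReal.ofReal_le_ofReal
    have hd := cz_dual_bound hψm hψi hb1 hε y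
    have hy := cz_young (abs_nonneg (h y))
      (abs_nonneg ((czF ψ (y + ε * Complex.I)).re / 3))
    rw [Real.cosh_abs] at hy
    have h3 : |(czF ψ (y + ε * Complex.I)).re / 3| = |(czF ψ (y + ε * Complex.I)).re| / 3 := by
      rw [abs_div, abs_of_pos (by norm_num : (0 : ℝ) < 3)]
    rw [h3] at hy
    have h4 := mul_le_mul_of_nonneg_right hd (abs_nonneg (h y))
    have h5 : Real.pi * |h y| ≤ 4 * (|h y| * (1 + logPlus |h y|)) := by
      have := Real.pi_le_four
      nlinarith [abs_nonneg (h y), mul_nonneg (abs_nonneg (h y)) hL]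
    nlinarith
  refine (lintegral_mono hpt).trans ?_
  have hlm : Measurable logPlus := by unfold logPlus; fun_prop
  rw [lintegral_add_left (by fun_prop), lintegral_const_mul' _ _ (by simp),
    lintegral_const_mul' _ _ (by simp)]
  refine add_le_add le_rfl ?_
  refine (mul_le_mul_right hcz _).trans_eq ?_
  rw [← ENNReal.ofReal_mul (by norm_num), ← mul_assoc, ENNReal.ofReal_mul (by norm_num),
    ENNReal.ofReal_toReal hSfin.ne]
  norm_num

theorem cz_trunc_eq {lam : ℝ} (g : ℝ → ℂ) (x : ℝ) :
    truncatedHilbert lam g x = ∫ y, (czK (1 / lam) (x - y) : ℂ) * g y := by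
  unfold truncatedHilbert
  rw [← integral_indicator (measurableSet_lt measurable_const (by fun_prop))]
  congr 1
  funext y
  by_cases hy : 1 / lam < |x - y|
  · rw [indicator_of_mem (show y ∈ {y : ℝ | 1 / lam < |x - y|} from hy), czK, if_pos hy]
    push_cast
    ring
  · rw [indicator_of_notMem (show y ∉ {y : ℝ | 1 / lam < |x - y|} from hy), czK, if_neg hy]
    simp

theorem cz_bounded {S : Set ℝ} (hS : MeasurableSet S) {M : ℝ} (hM : 0 < M)
    (hSM : S ⊆ Icc (-M) M) {lam : ℝ} (hlam : 0 < lam) {g : ℝ → ℂ} (hg : Measurable g)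
    (hN : ∫⁻ t : ℝ, ENNReal.ofReal (‖g t‖ * (1 + logPlus ‖g t‖)) < ⊤) :
    ∫⁻ x in S, ENNReal.ofReal ‖truncatedHilbert lam g x‖
      ≤ ENNReal.ofReal 20 * (∫⁻ t : ℝ, ENNReal.ofReal (‖g t‖ * (1 + logPlus ‖g t‖)))
        + ENNReal.ofReal 48 * volume S := by
  have hε : 0 < 1 / lam := by positivity
  have hgi : Integrable g := by
    refine ⟨hg.aestronglyMeasurable, ?_⟩
    refine lt_of_le_of_lt (lintegral_mono fun t => ?_) hN
    rw [← ofReal_norm]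
    apply ENNReal.ofReal_le_ofReal
    have := cz_logPlus_nonneg ‖g t‖
    nlinarith [norm_nonneg (g t), mul_nonneg (norm_nonneg (g t)) this]
  have hrem : Measurable (fun t => (g t).re) := Complex.measurable_re.comp hg
  have himm : Measurable (fun t => (g t).im) := Complex.measurable_im.comp hg
  have hre := cz_real hrem hgi.re hS hM hSM hε
  have him := cz_real himm hgi.im hS hM hSM hε
  have mono : ∀ a b : ℝ, |a| ≤ b → ENNReal.ofReal (|a| * (1 + logPlus |a|))
      ≤ ENNReal.ofReal (b * (1 + logPlus b)) := by
    intro a b hab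
    apply ENNReal.ofReal_le_ofReal
    have h1 := cz_logPlus_nonneg |a|
    have h2 := cz_logPlus_mono hab
    have h3 := (abs_nonneg a).trans hab
    gcongr
  have nre : (∫⁻ t, ENNReal.ofReal (|(g t).re| * (1 + logPlus |(g t).re|)))
      ≤ ∫⁻ t : ℝ, ENNReal.ofReal (‖g t‖ * (1 + logPlus ‖g t‖)) :=
    lintegral_mono fun t => mono _ _ (Complex.abs_re_le_norm _)
  have nim : (∫⁻ t, ENNReal.ofReal (|(g t).im| * (1 + logPlus |(g t).im|)))
      ≤ ∫⁻ t : ℝ, ENNReal.ofReal (‖g t‖ * (1 + logPlus ‖g t‖)) :=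
    lintegral_mono fun t => mono _ _ (Complex.abs_im_le_norm _)
  set N := ∫⁻ t : ℝ, ENNReal.ofReal (‖g t‖ * (1 + logPlus ‖g t‖)) with hNdef
  have hKi : ∀ x, Integrable (fun y => (czK (1 / lam) (x - y) : ℂ) * g y) := by
    intro x
    refine Integrable.mono' (hgi.norm.const_mul (1 / lam)⁻¹) ?_
      (Filter.Eventually.of_forall fun y => ?_)
    · have h1 : Measurable (fun y => czK (1 / lam) (x - y)) :=
        (czK_measurable _).comp (measurable_const.sub measurable_id)
      exact ((Complex.measurable_ofReal.comp h1).mul hg).aestronglyMeasurable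
    · rw [norm_mul, Complex.norm_real]
      gcongr
      exact czK_bound hε _
  have hR : ∀ x, (truncatedHilbert lam g x).re = ∫ y, czK (1 / lam) (x - y) * (g y).re := by
    intro x
    rw [cz_trunc_eq]
    have h := (RCLike.reCLM (K := ℂ)).integral_comp_comm (hKi x)
    refine (h.symm).trans ?_
    congr 1
    funext y
    exact Complex.re_ofReal_mul _ _
  have hI : ∀ x, (truncatedHilbert lam g x).im = ∫ y, czK (1 / lam) (x - y) * (g y).im := by
    intro x
    rw [cz_trunc_eq]
    have h := (RCLike.imCLM (K := ℂ)).integral_comp_comm (hKi x)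
    refine (h.symm).trans ?_
    congr 1
    funext y
    exact Complex.im_ofReal_mul _ _
  have hKm : Measurable (fun p : ℝ × ℝ => czK (1 / lam) (p.1 - p.2)) :=
    (czK_measurable _).comp (measurable_fst.sub measurable_snd)
  have hTm : Measurable (fun x => ∫ y, czK (1 / lam) (x - y) * (g y).re) := by
    apply StronglyMeasurable.measurable
    apply StronglyMeasurable.integral_prod_right
      (f := fun x y => czK (1 / lam) (x - y) * (g y).re)
    exact (hKm.mul (hrem.comp measurable_snd)).stronglyMeasurable
  calc ∫⁻ x in S, ENNReal.ofReal ‖truncatedHilbert lam g x‖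
      ≤ ∫⁻ x in S, (ENNReal.ofReal |∫ y, czK (1 / lam) (x - y) * (g y).re|
          + ENNReal.ofReal |∫ y, czK (1 / lam) (x - y) * (g y).im|) := by
        refine lintegral_mono fun x => ?_
        rw [← ENNReal.ofReal_add (abs_nonneg _) (abs_nonneg _), ← hR, ← hI]
        exact ENNReal.ofReal_le_ofReal (Complex.norm_le_abs_re_add_abs_im _)
    _ = (∫⁻ x in S, ENNReal.ofReal |∫ y, czK (1 / lam) (x - y) * (g y).re|)
          + ∫⁻ x in S, ENNReal.ofReal |∫ y, czK (1 / lam) (x - y) * (g y).im| :=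
        lintegral_add_left hTm.abs.ennreal_ofReal _
    _ ≤ (ENNReal.ofReal 10 * N + ENNReal.ofReal 24 * volume S)
          + (ENNReal.ofReal 10 * N + ENNReal.ofReal 24 * volume S) := by
        refine add_le_add (hre.trans ?_) (him.trans ?_) <;> gcongr
    _ = _ := by
        have e1 : ENNReal.ofReal 20 = ENNReal.ofReal 10 + ENNReal.ofReal 10 := by
          rw [← ENNReal.ofReal_add] <;> norm_num
        have e2 : ENNReal.ofReal 48 = ENNReal.ofReal 24 + ENNReal.ofReal 24 := by
          rw [← ENNReal.ofReal_add] <;> norm_num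
        rw [e1, e2]
        ring

/-- (Calderón–Zygmund) For any set `S` of finite measure there are constants `A_S, B_S`
such that `∫_S |g̃_λ| ≤ A_S ∫ |g|(1 + log⁺|g|) + B_S`, uniformly in `λ > 0`. -/
theorem calderon_zygmund_truncated_hilbert
    (S : Set ℝ) (hS : MeasurableSet S) (hSfin : volume S < ⊤) :
    ∃ A B : ℝ, 0 ≤ A ∧ 0 ≤ B ∧
      ∀ lam : ℝ, 0 < lam → ∀ g : ℝ → ℂ, Measurable g →
        (∫⁻ t : ℝ, ENNReal.ofReal (‖g t‖ * (1 + logPlus ‖g t‖)) < ⊤) →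
        ∫⁻ x in S, ENNReal.ofReal ‖truncatedHilbert lam g x‖
          ≤ ENNReal.ofReal A *
              (∫⁻ t : ℝ, ENNReal.ofReal (‖g t‖ * (1 + logPlus ‖g t‖))) +
            ENNReal.ofReal B := by
  refine ⟨20, 48 * (volume S).toReal, by norm_num, by positivity, ?_⟩
  intro lam hlam g hg hN
  have hU : S = ⋃ n : ℕ, S ∩ Icc (-((n : ℝ) + 1)) ((n : ℝ) + 1) := by
    rw [← inter_iUnion]
    symm
    apply inter_eq_left.2
    intro x _
    obtain ⟨n, hn⟩ := exists_nat_ge |x|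
    exact mem_iUnion.2 ⟨n, abs_le.1 (by linarith)⟩
  have hdir : Directed (· ⊆ ·) (fun n : ℕ => S ∩ Icc (-((n : ℝ) + 1)) ((n : ℝ) + 1)) := by
    apply Monotone.directed_le
    intro m n hmn
    have : (m : ℝ) ≤ n := by exact_mod_cast hmn
    exact inter_subset_inter_right _ (Icc_subset_Icc (by linarith) (by linarith))
  rw [ENNReal.ofReal_mul (by norm_num), ENNReal.ofReal_toReal hSfin.ne]
  conv_lhs => rw [hU]
  rw [setLIntegral_iUnion_of_directed _ hdir]
  refine iSup_le fun n => ?_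
  refine (cz_bounded (hS.inter measurableSet_Icc) (M := (n : ℝ) + 1) (by positivity)
    inter_subset_right hlam hg hN).trans ?_
  gcongr
  exact inter_subset_left

end
end

section
/- Let Ω = Δ ∪ (π − Δ) and let z₀ = π/2 + iπ/2 and z₁ = π/2 − iπ/2 be the upper and lower vertices of D. Then there exist functions χ₁, χ₂ ∈ C^∞(Ω) (viewed as functions of (x, y) ∈ Ω ⊆ ℝ²) and a constant C > 0 such that: (1) 0 ≤ χᵢ ≤ 1 and supp χ₁ ⊆ Δ, supp χ₂ ⊆ π − Δ; (2) χ₁ + χ₂ ≡ 1 on Ω; (3) for all z ∈ D, |(∂χ₁/∂z̄)(z)| ≤ C / (|z − z₀| · |z − z₁|), where ∂/∂z̄ = (1/2)(∂/∂x + i ∂/∂y). -/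
open MeasureTheory Set

noncomputable section

/-- The Wirtinger derivative `∂χ/∂z̄ = (1/2)(∂χ/∂x + i ∂χ/∂y)` of a real-valued
function on `ℂ ≃ ℝ²`. -/
def wirtingerBar (χ : ℂ → ℝ) (z : ℂ) : ℂ :=
  (1 / 2 : ℂ) * (((fderiv ℝ χ z 1 : ℝ) : ℂ) + Complex.I * ((fderiv ℝ χ z Complex.I : ℝ) : ℂ))

/-- The first logarithm argument. -/
def pouA (z : ℂ) : ℂ := ((Real.pi / 2 : ℝ) : ℂ) + Complex.I * (z - ((Real.pi / 2 : ℝ) : ℂ))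

/-- The second logarithm argument. -/
def pouB (z : ℂ) : ℂ := ((Real.pi / 2 : ℝ) : ℂ) - Complex.I * (z - ((Real.pi / 2 : ℝ) : ℂ))

/-- The angle function. -/
def pouTheta (z : ℂ) : ℝ := (Complex.log (pouA z) - Complex.log (pouB z)).im

lemma pouA_re (z : ℂ) : (pouA z).re = Real.pi / 2 - z.im := by
  simp [pouA, -Complex.ofReal_div]; ring
lemma pouA_im (z : ℂ) : (pouA z).im = z.re - Real.pi / 2 := by
  simp [pouA, -Complex.ofReal_div]
lemma pouB_re (z : ℂ) : (pouB z).re = Real.pi / 2 + z.im := by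
  simp [pouB, -Complex.ofReal_div]
lemma pouB_im (z : ℂ) : (pouB z).im = Real.pi / 2 - z.re := by
  simp [pouB, -Complex.ofReal_div]

lemma mem_delta (z : ℂ) : z ∈ SectorDelta ↔ |z.im| < z.re := by
  refine ⟨fun h => h.2, fun h => ⟨lt_of_le_of_lt (abs_nonneg _) h, h⟩⟩

lemma mem_piDelta (z : ℂ) : z ∈ SectorPiDelta ↔ |z.im| < Real.pi - z.re := by
  constructor
  · rintro ⟨w, hw, rfl⟩
    have := hw.2
    simpa using this
  · intro h
    refine ⟨(Real.pi : ℂ) - z, ?_, by simp⟩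
    rw [mem_delta]
    simpa using h

lemma omega_open : IsOpen (SectorDelta ∪ SectorPiDelta) := by
  have h1 : SectorDelta = {z : ℂ | |z.im| < z.re} := by
    ext z; exact mem_delta z
  have h2 : SectorPiDelta = {z : ℂ | |z.im| < Real.pi - z.re} := by
    ext z; exact mem_piDelta z
  rw [h1, h2]
  apply IsOpen.union
  · exact isOpen_lt (by fun_prop) (by fun_prop)
  · exact isOpen_lt (by fun_prop) (by fun_prop)

lemma pouA_slit {z : ℂ} (hz : z ∈ SectorDelta ∪ SectorPiDelta) : pouA z ∈ Complex.slitPlane := by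
  rw [Complex.mem_slitPlane_iff, pouA_re, pouA_im]
  by_cases h : z.re - Real.pi / 2 = 0
  · left
    rcases hz with hz | hz
    · rw [mem_delta, abs_lt] at hz; linarith [hz.2]
    · rw [mem_piDelta, abs_lt] at hz; linarith [hz.2]
  · exact Or.inr h

lemma pouB_slit {z : ℂ} (hz : z ∈ SectorDelta ∪ SectorPiDelta) : pouB z ∈ Complex.slitPlane := by
  rw [Complex.mem_slitPlane_iff, pouB_re, pouB_im]
  by_cases h : Real.pi / 2 - z.re = 0
  · left
    rcases hz with hz | hz
    · rw [mem_delta, abs_lt] at hz; linarith [hz.1]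
    · rw [mem_piDelta, abs_lt] at hz; linarith [hz.1]
  · exact Or.inr h

lemma arg_gt_half {w : ℂ} (h0 : 0 < w.im) (h : w.re ≤ w.im) : 1 / 2 < w.arg := by
  by_contra! hc
  have hp : 0 ≤ w.arg := Complex.arg_nonneg_iff.2 h0.le
  have hw : w ≠ 0 := by rintro rfl; simp at h0
  have hn : 0 < ‖w‖ := norm_pos_iff.2 hw
  have hs : Real.sin w.arg ≤ 1 / 2 := (Real.sin_le hp).trans hc
  have hcos := Real.one_sub_sq_div_two_le_cos (x := w.arg)
  have h1 := Complex.norm_mul_cos_arg w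
  have h2 := Complex.norm_mul_sin_arg w
  have hcos' : 7 / 8 ≤ Real.cos w.arg := by nlinarith
  nlinarith [mul_le_mul_of_nonneg_left hs hn.le, mul_le_mul_of_nonneg_left hcos' hn.le]

lemma arg_lt_neg_half {w : ℂ} (h0 : w.im < 0) (h : w.re ≤ -w.im) : w.arg < -(1 / 2) := by
  have h1 : 1 / 2 < ((starRingEnd ℂ) w).arg := by
    apply arg_gt_half <;> simpa
  rw [Complex.arg_conj, if_neg] at h1
  · linarith
  · intro h2
    rw [Complex.arg_eq_pi_iff] at h2
    linarith [h2.2]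

lemma pouTheta_eq (z : ℂ) : pouTheta z = (pouA z).arg - (pouB z).arg := by
  simp [pouTheta, Complex.log_im]

lemma theta_gt {z : ℂ} (hz : z ∈ SectorDelta ∪ SectorPiDelta) (h : z ∉ SectorPiDelta) :
    1 / 2 < pouTheta z := by
  have h1 : z ∈ SectorDelta := hz.resolve_right h
  rw [mem_delta] at h1
  rw [mem_piDelta, not_lt] at h
  have hu : 0 < z.re - Real.pi / 2 := by linarith
  rw [pouTheta_eq]
  have a0 : 0 ≤ (pouA z).arg := by rw [Complex.arg_nonneg_iff, pouA_im]; exact hu.le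
  have b0 : (pouB z).arg < 0 := by rw [Complex.arg_neg_iff, pouB_im]; linarith
  rcases abs_cases z.im with ⟨e, -⟩ | ⟨e, -⟩
  · have := arg_gt_half (w := pouA z) (by rw [pouA_im]; exact hu)
      (by rw [pouA_im, pouA_re]; linarith)
    linarith
  · have := arg_lt_neg_half (w := pouB z) (by rw [pouB_im]; linarith)
      (by rw [pouB_im, pouB_re]; linarith)
    linarith

lemma theta_lt {z : ℂ} (hz : z ∈ SectorDelta ∪ SectorPiDelta) (h : z ∉ SectorDelta) :
    pouTheta z < -(1 / 2) := by
  have h1 : z ∈ SectorPiDelta := hz.resolve_left h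
  rw [mem_piDelta] at h1
  rw [mem_delta, not_lt] at h
  have hu : z.re - Real.pi / 2 < 0 := by linarith
  rw [pouTheta_eq]
  have a0 : (pouA z).arg < 0 := by rw [Complex.arg_neg_iff, pouA_im]; exact hu
  have b0 : 0 ≤ (pouB z).arg := by rw [Complex.arg_nonneg_iff, pouB_im]; linarith
  rcases abs_cases z.im with ⟨e, -⟩ | ⟨e, -⟩
  · have := arg_lt_neg_half (w := pouA z) (by rw [pouA_im]; exact hu)
      (by rw [pouA_im, pouA_re]; linarith)
    linarith
  · have := arg_gt_half (w := pouB z) (by rw [pouB_im]; linarith)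
      (by rw [pouB_im, pouB_re]; linarith)
    linarith

lemma theta_contDiffAt {z : ℂ} (hz : z ∈ SectorDelta ∪ SectorPiDelta) :
    ContDiffAt ℝ (⊤ : ℕ∞) pouTheta z := by
  have hA : ContDiffAt ℂ (⊤ : ℕ∞) (fun z => Complex.log (pouA z) - Complex.log (pouB z)) z := by
    apply ContDiffAt.sub
    · refine (Complex.contDiffAt_log (pouA_slit hz)).comp z ?_
      unfold pouA; fun_prop
    · refine (Complex.contDiffAt_log (pouB_slit hz)).comp z ?_
      unfold pouB; fun_prop
  exact Complex.imCLM.contDiff.contDiffAt.comp z (hA.restrict_scalars ℝ)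

lemma theta_hasFDerivAt {z : ℂ} (hz : z ∈ SectorDelta ∪ SectorPiDelta) :
    ∃ L : ℂ →L[ℝ] ℝ, HasFDerivAt pouTheta L z ∧
      ∀ h : ℂ, |L h| ≤ Real.pi / (‖pouA z‖ * ‖pouB z‖) * ‖h‖ := by
  have hA : HasDerivAt pouA Complex.I z := by
    unfold pouA
    simpa using (((hasDerivAt_id z).sub_const (((Real.pi / 2 : ℝ) : ℂ))).const_mul Complex.I).const_add
      (((Real.pi / 2 : ℝ) : ℂ))
  have hB : HasDerivAt pouB (-Complex.I) z := by
    unfold pouB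
    simpa using (((hasDerivAt_id z).sub_const (((Real.pi / 2 : ℝ) : ℂ))).const_mul Complex.I).const_sub
      (((Real.pi / 2 : ℝ) : ℂ))
  have hF := (hA.clog (pouA_slit hz)).sub (hB.clog (pouB_slit hz))
  have hA0 : pouA z ≠ 0 := Complex.slitPlane_ne_zero (pouA_slit hz)
  have hB0 : pouB z ≠ 0 := Complex.slitPlane_ne_zero (pouB_slit hz)
  have key : Complex.I / pouA z - -Complex.I / pouB z =
      Complex.I * (Real.pi : ℂ) / (pouA z * pouB z) := by
    have hs : pouA z + pouB z = (Real.pi : ℂ) := by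
      unfold pouA pouB; push_cast; ring
    rw [← hs]; field_simp; ring
  rw [key] at hF
  have hn : ‖Complex.I * (Real.pi : ℂ) / (pouA z * pouB z)‖ =
      Real.pi / (‖pouA z‖ * ‖pouB z‖) := by
    simp [abs_of_pos Real.pi_pos]
  refine ⟨_, Complex.imCLM.hasFDerivAt.comp z (hF.hasFDerivAt.restrictScalars ℝ), fun h => ?_⟩
  rw [← hn, ← norm_mul]
  refine le_trans (le_of_eq ?_) (Complex.abs_im_le_norm _)
  simp [mul_comm]

lemma theta_abs (z : ℂ) : |pouTheta z| ≤ 2 * Real.pi := by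
  rw [pouTheta_eq, abs_le]
  have := Complex.neg_pi_lt_arg (pouA z)
  have := Complex.neg_pi_lt_arg (pouB z)
  have := Complex.arg_le_pi (pouA z)
  have := Complex.arg_le_pi (pouB z)
  constructor <;> linarith

/-- The cutoff. -/
def pouChi (z : ℂ) : ℝ := Real.smoothTransition (1 / 2 + pouTheta z)

lemma chi_bound : ∃ M : ℝ, 0 < M ∧ ∀ z ∈ SectorDelta ∪ SectorPiDelta, ∀ h : ℂ,
    |fderiv ℝ pouChi z h| ≤ M / (‖pouA z‖ * ‖pouB z‖) * ‖h‖ := by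
  have hS : ContDiff ℝ 1 Real.smoothTransition := Real.smoothTransition.contDiff
  have hc : Continuous (deriv Real.smoothTransition) := hS.continuous_deriv le_rfl
  obtain ⟨K, hK⟩ := (isCompact_Icc (a := 1 / 2 - 2 * Real.pi)
    (b := 1 / 2 + 2 * Real.pi)).exists_bound_of_continuousOn hc.continuousOn
  refine ⟨(|K| + 1) * Real.pi, by positivity, fun z hz h => ?_⟩
  obtain ⟨L, hL, hLb⟩ := theta_hasFDerivAt hz
  have hd := ((hS.differentiable one_ne_zero) (1 / 2 + pouTheta z)).hasDerivAt
  have hcomp := hd.comp_hasFDerivAt z (hL.const_add (1 / 2))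
  have he : fderiv ℝ pouChi z = deriv Real.smoothTransition (1 / 2 + pouTheta z) • L :=
    hcomp.fderiv
  rw [he]
  have ht := abs_le.1 (theta_abs z)
  have hk := hK (1 / 2 + pouTheta z) ⟨by linarith [ht.1], by linarith [ht.2]⟩
  rw [Real.norm_eq_abs] at hk
  have hk' : |deriv Real.smoothTransition (1 / 2 + pouTheta z)| ≤ |K| + 1 := by
    linarith [le_abs_self K]
  calc |(deriv Real.smoothTransition (1 / 2 + pouTheta z) • L) h|
      = |deriv Real.smoothTransition (1 / 2 + pouTheta z)| * |L h| := by
        simp [abs_mul]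
    _ ≤ (|K| + 1) * (Real.pi / (‖pouA z‖ * ‖pouB z‖) * ‖h‖) := by
        gcongr
        exact hLb h
    _ = _ := by ring

/-- A smooth partition of unity `{χ₁, χ₂}` on `Ω = Δ ∪ (π − Δ)` subordinate to
`{Δ, π − Δ}` whose `∂̄`-derivative satisfies `|∂χ₁/∂z̄| ≤ C/(|z−z₀||z−z₁|)` on `D`,
where `z₀, z₁` are the upper and lower vertices of `D`. -/
theorem partition_of_unity_with_dbar_estimate
    (z₀ z₁ : ℂ) (hz₀ : z₀ = ((Real.pi / 2 : ℝ) : ℂ) + ((Real.pi / 2 : ℝ) : ℂ) * Complex.I)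
    (hz₁ : z₁ = ((Real.pi / 2 : ℝ) : ℂ) - ((Real.pi / 2 : ℝ) : ℂ) * Complex.I) :
    ∃ χ₁ χ₂ : ℂ → ℝ, ∃ C : ℝ, 0 < C ∧
      ContDiffOn ℝ (⊤ : ℕ∞) χ₁ (SectorDelta ∪ SectorPiDelta) ∧
      ContDiffOn ℝ (⊤ : ℕ∞) χ₂ (SectorDelta ∪ SectorPiDelta) ∧
      (∀ z ∈ SectorDelta ∪ SectorPiDelta, 0 ≤ χ₁ z ∧ χ₁ z ≤ 1) ∧
      (∀ z ∈ SectorDelta ∪ SectorPiDelta, 0 ≤ χ₂ z ∧ χ₂ z ≤ 1) ∧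
      (SectorDelta ∪ SectorPiDelta) ∩ tsupport χ₁ ⊆ SectorDelta ∧
      (SectorDelta ∪ SectorPiDelta) ∩ tsupport χ₂ ⊆ SectorPiDelta ∧
      (∀ z ∈ SectorDelta ∪ SectorPiDelta, χ₁ z + χ₂ z = 1) ∧
      (∀ z ∈ SquareD, ‖wirtingerBar χ₁ z‖ ≤ C / (‖z - z₀‖ * ‖z - z₁‖)) := by
  have hcd : ∀ z ∈ SectorDelta ∪ SectorPiDelta, ContDiffAt ℝ (⊤ : ℕ∞) pouChi z := by
    intro z hz
    exact Real.smoothTransition.contDiffAt.comp z (contDiffAt_const.add (theta_contDiffAt hz))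
  obtain ⟨M, hM, hMb⟩ := chi_bound
  refine ⟨pouChi, fun z => 1 - pouChi z, M, hM,
    fun z hz => (hcd z hz).contDiffWithinAt,
    fun z hz => (contDiffAt_const.sub (hcd z hz)).contDiffWithinAt,
    fun z _ => ⟨Real.smoothTransition.nonneg _, Real.smoothTransition.le_one _⟩,
    fun z _ => ⟨sub_nonneg.2 (Real.smoothTransition.le_one _),
      sub_le_self _ (Real.smoothTransition.nonneg _)⟩, ?_, ?_, fun z _ => by ring, ?_⟩
  · rintro z ⟨hz, hs⟩
    by_contra hn
    have hev : ∀ᶠ w in nhds z, pouTheta w < -(1 / 2) :=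
      (theta_contDiffAt hz).continuousAt.eventually_lt continuousAt_const (theta_lt hz hn)
    refine (notMem_tsupport_iff_eventuallyEq.2 ?_) hs
    filter_upwards [hev] with w hw
    exact Real.smoothTransition.zero_of_nonpos (by linarith)
  · rintro z ⟨hz, hs⟩
    by_contra hn
    have hev : ∀ᶠ w in nhds z, 1 / 2 < pouTheta w :=
      continuousAt_const.eventually_lt (theta_contDiffAt hz).continuousAt (theta_gt hz hn)
    refine (notMem_tsupport_iff_eventuallyEq.2 ?_) hs
    filter_upwards [hev] with w hw
    have : pouChi w = 1 := Real.smoothTransition.one_of_one_le (by linarith)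
    simp [this]
  · intro z hz
    have hz' : z ∈ SectorDelta ∪ SectorPiDelta := Or.inl hz.1
    have hA : ‖pouA z‖ = ‖z - z₀‖ := by
      have : pouA z = Complex.I * (z - z₀) := by
        rw [hz₀]; unfold pouA; linear_combination (((Real.pi / 2 : ℝ) : ℂ)) * Complex.I_mul_I
      rw [this]; simp
    have hB : ‖pouB z‖ = ‖z - z₁‖ := by
      have : pouB z = -Complex.I * (z - z₁) := by
        rw [hz₁]; unfold pouB; linear_combination (((Real.pi / 2 : ℝ) : ℂ)) * Complex.I_mul_I
      rw [this]; simp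
    have h1 := hMb z hz' 1
    have h2 := hMb z hz' Complex.I
    rw [hA, hB] at h1 h2
    simp only [norm_one, Complex.norm_I, mul_one] at h1 h2
    unfold wirtingerBar
    rw [norm_mul]
    have h3 := norm_add_le ((fderiv ℝ pouChi z 1 : ℝ) : ℂ)
      (Complex.I * ((fderiv ℝ pouChi z Complex.I : ℝ) : ℂ))
    rw [norm_mul, Complex.norm_I, one_mul, Complex.norm_real, Complex.norm_real,
      Real.norm_eq_abs, Real.norm_eq_abs] at h3
    have h4 : ‖(1 / 2 : ℂ)‖ = 1 / 2 := by norm_num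
    rw [h4]
    linarith

end
end
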